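/- arXiv:math/0010140 — 3 statements merged into one kernel-verified Lean document; each statement's English description precedes it below -/
import Mathlib

section
/- (Theorem 5.6; Ohno's relation.) Let s = (k₁,…,k_l) be an admissible sequence and let τ(s) = (k'₁,…,k'_{l'}) be its dual sequence. Then for every integer n ≥ 0, ∑_{c₁+⋯+c_l = n, c_i ≥ 0} ζ(k₁+c₁, k₂+c₂, …, k_l+c_l) = ∑_{d₁+⋯+d_{l'} = n, d_j ≥ 0} ζ(k'₁+d₁, k'₂+d₂, …, k'_{l'}+d_{l'}). -/
/-- The multiple zeta value `ζ(k₁,…,k_l) = ∑_{n₁>n₂>⋯>n_l≥1} 1/(n₁^{k₁} ⋯ n_l^{k_l})`. -/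
noncomputable def mzv (k : List ℕ) : ℝ :=
  ∑' n : Fin k.length → ℕ,
    if (∀ i j : Fin k.length, i < j → n j < n i) ∧ (∀ i, 1 ≤ n i) then
      ∏ i : Fin k.length, ((n i : ℝ) ^ k.get i)⁻¹
    else 0

/-- Partial sums Σ(s) = (k₁, k₁+k₂, …, k₁+⋯+k_l). -/
def partialSums (k : List ℕ) : List ℕ :=
  (List.range k.length).map fun i => (k.take (i + 1)).sum

/-- Inverse of `partialSums`: the sequence of successive differences. -/
def unPartial (a : List ℕ) : List ℕ :=
  List.zipWith (· - ·) a (0 :: a)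

/-- The dual sequence τ(s) = Σ⁻¹(C_n(R_n(Σ(s)))) of an admissible sequence `s` of weight `n`,
where `R_n(a₁,…,a_i) = (n+1-a_i,…,n+1-a₁)` and `C_n` takes the complement in `{1,…,n}`
in increasing order. -/
def dualSeq (k : List ℕ) : List ℕ :=
  let n := k.sum
  let r := (partialSums k).reverse.map fun a => n + 1 - a
  let c := ((List.range n).map (· + 1)).filter fun m => m ∉ r
  unPartial c

namespace Ohno
open Filter Topology
open scoped ENNReal

/-- weight `1/m` (zero at `m = 0`) -/
noncomputable def iv (m : ℕ) : ℝ≥0∞ := ENNReal.ofReal ((m : ℝ)⁻¹)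
/-- weight `1/(m-x)` -/
noncomputable def jx (x : ℝ) (m : ℕ) : ℝ≥0∞ := ENNReal.ofReal (((m : ℝ) - x)⁻¹)

/-- nested sums attached to binary words, with the largest summation variable fixed -/
noncomputable def W (x : ℝ) : List Bool → ℕ → ℝ≥0∞
  | [], m => if m = 0 then 1 else 0
  | true :: w, m => jx x m * ∑' j : ℕ, if j < m then W x w j else 0
  | false :: w, m => iv m * W x w m

noncomputable def P (x : ℝ) (m : ℕ) : ℝ := ∏ i ∈ Finset.range m, ((i : ℝ) + 1 - x)

/-- the connector -/
noncomputable def C (x : ℝ) (m n : ℕ) : ℝ := P x m * P x n / P x (m + n)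

noncomputable def Z (x : ℝ) (u v : List Bool) : ℝ≥0∞ :=
  ∑' m : ℕ, ∑' n : ℕ, W x u m * W x v n * ENNReal.ofReal (C x m n)

lemma P_pos {x : ℝ} (hx : x < 1) (m : ℕ) : 0 < P x m := by
  apply Finset.prod_pos
  intro i _
  have : (0 : ℝ) ≤ i := Nat.cast_nonneg i
  linarith

lemma P_succ (x : ℝ) (m : ℕ) : P x (m + 1) = P x m * ((m : ℝ) + 1 - x) := by
  simp [P, Finset.prod_range_succ]

lemma C_nonneg {x : ℝ} (hx : x < 1) (m n : ℕ) : 0 ≤ C x m n :=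
  div_nonneg (mul_nonneg (P_pos hx m).le (P_pos hx n).le) (P_pos hx _).le

lemma C_symm (x : ℝ) (m n : ℕ) : C x m n = C x n m := by
  simp only [C, mul_comm, add_comm]

lemma C_zero {x : ℝ} (hx : x < 1) (m : ℕ) : C x m 0 = 1 := by
  have := (P_pos hx m).ne'
  simp only [C, add_zero]
  rw [show P x 0 = 1 by simp [P]]
  field_simp

lemma C_step {x : ℝ} (hx : x < 1) (m n : ℕ) :
    C x m n - C x (m + 1) n = n * (((m + 1 : ℕ) : ℝ) - x)⁻¹ * C x (m + 1) n := by
  have h1 := (P_pos hx m).ne'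
  have h2 := (P_pos hx n).ne'
  have h3 := (P_pos hx (m + n)).ne'
  have hm : (0 : ℝ) ≤ m := Nat.cast_nonneg m
  have hn : (0 : ℝ) ≤ n := Nat.cast_nonneg n
  have h4 : (m : ℝ) + 1 - x ≠ 0 := by linarith
  have h5 : (m : ℝ) + n + 1 - x ≠ 0 := by linarith
  simp only [C]
  rw [show m + 1 + n = (m + n) + 1 by ring, P_succ, P_succ]
  push_cast
  field_simp
  ring

lemma C_le {x : ℝ} (hx0 : 0 ≤ x) (hx : x < 1) (m n : ℕ) :
    C x m (n + 1) ≤ (1 - x) * ((m : ℝ) + 1 - x)⁻¹ := by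
  have hm : (0 : ℝ) ≤ m := Nat.cast_nonneg m
  induction n with
  | zero =>
    have h1 := (P_pos hx m).ne'
    have h4 : (m : ℝ) + 1 - x ≠ 0 := by linarith
    simp only [C, zero_add]
    rw [P_succ x m, show P x 1 = 1 - x by simp [P]]
    apply le_of_eq
    field_simp
  | succ n ih =>
    refine le_trans ?_ ih
    have := C_step hx (n + 1) m
    rw [C_symm x (n + 1) m, C_symm x (n + 1 + 1) m] at this
    have h2 : 0 ≤ (m : ℝ) * (((n + 1 + 1 : ℕ) : ℝ) - x)⁻¹ * C x m (n + 1 + 1) := by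
      have : (0 : ℝ) ≤ ((n + 1 + 1 : ℕ) : ℝ) - x := by
        push_cast; have : (0 : ℝ) ≤ n := Nat.cast_nonneg n
        linarith
      have := C_nonneg hx m (n + 1 + 1)
      positivity
    linarith

lemma C_tendsto {x : ℝ} (hx0 : 0 ≤ x) (hx : x < 1) (n : ℕ) (hn : n ≠ 0) :
    Tendsto (fun m => C x m n) atTop (𝓝 0) := by
  obtain ⟨n, rfl⟩ := Nat.exists_eq_succ_of_ne_zero hn
  refine squeeze_zero (fun m => C_nonneg hx _ _) (fun m => C_le hx0 hx m n) ?_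
  rw [show (0 : ℝ) = (1 - x) * 0 by simp]
  apply Tendsto.const_mul
  apply Tendsto.inv_tendsto_atTop
  have : Tendsto (fun m : ℕ => (m : ℝ) + (1 - x)) atTop atTop :=
    tendsto_atTop_add_const_right _ _ tendsto_natCast_atTop_atTop
  simpa [add_sub_assoc] using this

lemma tele {x : ℝ} (hx0 : 0 ≤ x) (hx : x < 1) (j n : ℕ) (hn : n ≠ 0) :
    ∑' m : ℕ, (if j < m then jx x m * ENNReal.ofReal (C x m n) else 0)
      = iv n * ENNReal.ofReal (C x j n) := by
  have hnn : (n : ℝ) ≠ 0 := by exact_mod_cast hn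
  have hpos : ∀ m : ℕ, j < m → 0 ≤ ((m : ℝ) - x)⁻¹ := by
    intro m hm
    have : (1 : ℝ) ≤ m := by exact_mod_cast (by omega : 1 ≤ m)
    apply inv_nonneg.2; linarith
  have hnonneg : ∀ m : ℕ, 0 ≤ (if j < m then ((m : ℝ) - x)⁻¹ * C x m n else 0) := by
    intro m; split_ifs with h
    · exact mul_nonneg (hpos m h) (C_nonneg hx _ _)
    · exact le_rfl
  have hs : HasSum (fun m : ℕ => if j < m then ((m : ℝ) - x)⁻¹ * C x m n else 0)
      ((n : ℝ)⁻¹ * C x j n) := by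
    rw [hasSum_iff_tendsto_nat_of_nonneg hnonneg]
    rw [← tendsto_add_atTop_iff_nat (j + 1)]
    have hsum : ∀ N : ℕ, ∑ m ∈ Finset.range (N + (j + 1)),
        (if j < m then ((m : ℝ) - x)⁻¹ * C x m n else 0)
        = (n : ℝ)⁻¹ * (C x j n - C x (N + j) n) := by
      intro N
      induction N with
      | zero =>
        simp only [zero_add, sub_self, mul_zero]
        apply Finset.sum_eq_zero
        intro m hm
        rw [Finset.mem_range] at hm
        rw [if_neg (by omega)]
      | succ N ih =>
        rw [show N + 1 + (j + 1) = N + (j + 1) + 1 by ring, Finset.sum_range_succ, ih,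
          if_pos (by omega)]
        have := C_step hx (N + j) n
        rw [show N + (j + 1) = N + j + 1 by ring, show N + 1 + j = N + j + 1 by ring]
        rw [show C x j n - C x (N + j + 1) n = (C x j n - C x (N + j) n)
          + (C x (N + j) n - C x (N + j + 1) n) by ring, this]
        field_simp
    simp only [hsum]
    have h0 := (C_tendsto hx0 hx n hn).comp (tendsto_add_atTop_nat j)
    have := ((h0.const_sub (C x j n)).const_mul ((n : ℝ)⁻¹))
    simpa using this
  have := ENNReal.ofReal_tsum_of_nonneg hnonneg hs.summable
  rw [hs.tsum_eq, ENNReal.ofReal_mul (by positivity)] at this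
  rw [iv, this]
  apply tsum_congr
  intro m
  split_ifs with h
  · rw [ENNReal.ofReal_mul (hpos m h), jx]
  · simp

lemma W_zero (x : ℝ) (v : List Bool) (hv : v ≠ []) : W x v 0 = 0 := by
  match v with
  | [] => exact absurd rfl hv
  | true :: w => simp [W]
  | false :: w => simp [W, iv]

lemma Z_symm (x : ℝ) (u v : List Bool) : Z x u v = Z x v u := by
  unfold Z
  rw [ENNReal.tsum_comm]
  refine tsum_congr fun n => tsum_congr fun m => ?_
  rw [C_symm, mul_comm (W x u m)]

lemma stepT {x : ℝ} (hx0 : 0 ≤ x) (hx : x < 1) (u v : List Bool) (hv : v ≠ []) :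
    Z x (true :: u) v = Z x u (false :: v) := by
  unfold Z
  rw [ENNReal.tsum_comm]
  rw [ENNReal.tsum_comm (f := fun m n => W x u m * W x (false :: v) n * ENNReal.ofReal (C x m n))]
  refine tsum_congr fun n => ?_
  by_cases hn : n = 0
  · subst hn
    simp [W_zero x v hv, W_zero x (false :: v) (by simp)]
  calc ∑' m, W x (true :: u) m * W x v n * ENNReal.ofReal (C x m n)
      = ∑' m, ∑' j, W x u j * W x v n *
          (if j < m then jx x m * ENNReal.ofReal (C x m n) else 0) := by
        refine tsum_congr fun m => ?_
        rw [show W x (true :: u) m * W x v n * ENNReal.ofReal (C x m n) =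
          (jx x m * W x v n * ENNReal.ofReal (C x m n)) * ∑' j, if j < m then W x u j else 0 by
            simp only [W]; ring]
        rw [← ENNReal.tsum_mul_left]
        refine tsum_congr fun j => ?_
        split_ifs
        · ring
        · simp
    _ = ∑' j, ∑' m, W x u j * W x v n *
          (if j < m then jx x m * ENNReal.ofReal (C x m n) else 0) := ENNReal.tsum_comm
    _ = _ := by
        refine tsum_congr fun j => ?_
        rw [ENNReal.tsum_mul_left, tele hx0 hx j n hn]
        simp only [W]; ring

lemma stepF {x : ℝ} (hx0 : 0 ≤ x) (hx : x < 1) (u v : List Bool) (hu : u ≠ []) :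
    Z x (false :: u) v = Z x u (true :: v) := by
  rw [Z_symm, ← stepT hx0 hx v u hu, Z_symm]

lemma transport {x : ℝ} (hx0 : 0 ≤ x) (hx : x < 1) (u : List Bool) :
    ∀ v : List Bool, u.getLast? = some true → (v ≠ [] ∨ u.head? = some false) →
    Z x u v = Z x [] ((u.map not).reverse ++ v) := by
  induction u with
  | nil => intro v h; simp at h
  | cons b u ih =>
    intro v h hv
    by_cases hu : u = []
    · subst hu
      simp at h
      subst h
      simp at hv
      rw [stepT hx0 hx _ _ hv]
      simp
    · have hl : u.getLast? = some true := by
        rw [List.getLast?_cons] at h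
        rcases hq : u.getLast? with _ | q
        · simp at hq; exact absurd hq hu
        · simp [hq] at h; simp [h]
      cases b with
      | true =>
        simp at hv
        rw [stepT hx0 hx _ _ hv, ih _ hl (Or.inl (by simp))]
        simp
      | false =>
        rw [stepF hx0 hx _ _ hu, ih _ hl (Or.inl (by simp))]
        simp

lemma Z_nil {x : ℝ} (hx : x < 1) (v : List Bool) : Z x v [] = ∑' n, W x v n := by
  unfold Z
  refine tsum_congr fun n => ?_
  rw [tsum_eq_single 0]
  · simp [W, C_zero hx]
  · intro m hm; simp [W, hm]

/-- duality of the `x`-deformed nested sums -/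
lemma word_dual {x : ℝ} (hx0 : 0 ≤ x) (hx : x < 1) (u : List Bool)
    (h1 : u.getLast? = some true) (h2 : u.head? = some false) :
    ∑' n, W x u n = ∑' n, W x (u.map not).reverse n := by
  rw [← Z_nil hx, transport hx0 hx u [] h1 (Or.inr h2), Z_symm, Z_nil hx]
  simp

lemma iv_le_one (m : ℕ) : iv m ≤ 1 := by
  unfold iv
  rw [ENNReal.ofReal_le_one]
  exact Nat.cast_inv_le_one m

lemma W_le (x : ℝ) (w : List Bool) : ∀ m, W x w m ≤ W x (w.filter id) m := by
  induction w with
  | nil => intro m; simp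
  | cons b w ih =>
    intro m
    cases b with
    | true =>
      simp only [List.filter_cons, id, if_true, W]
      gcongr with j
      split_ifs
      · exact ih j
      · exact le_rfl
    | false =>
      simp only [List.filter_cons, id, W]
      calc iv m * W x w m ≤ 1 * W x w m := by gcongr; exact iv_le_one m
        _ = W x w m := one_mul _
        _ ≤ _ := by simpa using ih m

lemma W_repl (x : ℝ) (r : ℕ) (m : ℕ) (w : List Bool) :
    W x (List.replicate r false ++ w) m = iv m ^ r * W x w m := by
  induction r with
  | zero => simp
  | succ r ih => simp only [List.replicate_succ, List.cons_append, W, ih]; ring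

lemma W_single (x : ℝ) (m : ℕ) : W x [true] m = if m = 0 then 0 else jx x m := by
  by_cases hm : m = 0
  · subst hm; simp [W]
  · simp only [W, hm, if_false]
    rw [tsum_eq_single 0]
    · simp [Nat.pos_of_ne_zero hm]
    · intro j hj; simp [hj]

lemma finite_half (u : List Bool)
    (h1 : u.getLast? = some true) (h2 : u.head? = some false) :
    ∑' n, W (1/2) u n ≠ ⊤ := by
  obtain ⟨b, u, rfl⟩ : ∃ b u', u = b :: u' := by
    cases u with
    | nil => simp at h1
    | cons b u => exact ⟨b, u, rfl⟩
  simp at h2; subst h2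
  obtain ⟨r, hr⟩ : ∃ r, u.filter id = List.replicate (r + 1) true := by
    have h : u.filter id = List.replicate (u.filter id).length true := by
      rw [List.eq_replicate_iff]; simp
    have : true ∈ u := by
      have := List.mem_of_getLast? h1
      simpa using this
    have : (u.filter id).length ≠ 0 := by
      intro h0
      have hm : true ∈ u.filter id := by simp [this]
      rw [List.length_eq_zero_iff] at h0
      simp [h0] at hm
    obtain ⟨r, hr⟩ := Nat.exists_eq_succ_of_ne_zero this
    exact ⟨r, by rw [h, hr]⟩
  have hle : ∑' n, W (1/2) (false :: u) n ≤ ∑' n, W (1/2) (false :: List.replicate (r+1) true) n := by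
    apply ENNReal.tsum_le_tsum
    intro n
    simp only [W]
    gcongr
    rw [← hr]
    exact W_le _ _ _
  refine ne_top_of_le_ne_top ?_ hle
  rw [word_dual (by norm_num) (by norm_num) _ (by simp [List.getLast?_cons, List.getLast?_replicate]) (by simp)]
  rw [show ((false :: List.replicate (r+1) true).map not).reverse
    = List.replicate (r+1) false ++ [true] by simp]
  have hs : Summable (fun n : ℕ => 2 * ((n : ℝ) ^ 2)⁻¹) :=
    (Real.summable_nat_pow_inv.2 (by norm_num)).mul_left 2
  refine ne_top_of_le_ne_top hs.tsum_ofReal_ne_top ?_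
  apply ENNReal.tsum_le_tsum
  intro n
  rw [W_repl, W_single]
  split_ifs with hn
  · simp
  · have h1n : (1 : ℝ) ≤ n := by exact_mod_cast Nat.one_le_iff_ne_zero.2 hn
    calc iv n ^ (r + 1) * jx (1/2) n ≤ iv n * jx (1/2) n := by
          gcongr
          rw [pow_succ]
          calc iv n ^ r * iv n ≤ 1 * iv n := by gcongr; exact pow_le_one₀ (by simp) (iv_le_one n)
            _ = _ := one_mul _
      _ ≤ _ := by
          unfold iv jx
          rw [← ENNReal.ofReal_mul (by positivity)]
          apply ENNReal.ofReal_le_ofReal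
          have : ((n : ℝ) - 1/2)⁻¹ ≤ 2 * (n : ℝ)⁻¹ := by
            rw [inv_le_iff_one_le_mul₀ (by linarith)]
            have : (n : ℝ) ≠ 0 := by linarith
            field_simp
            linarith
          calc (n : ℝ)⁻¹ * ((n : ℝ) - 1/2)⁻¹ ≤ (n : ℝ)⁻¹ * (2 * (n : ℝ)⁻¹) := by gcongr
            _ = _ := by field_simp
end Ohno

namespace Ohno
open Filter Topology
open scoped ENNReal

lemma coeff_unique (a b : ℕ → ℝ≥0∞)
    (h : ∀ x : ℝ, 0 ≤ x → x < 1 → ∑' n, ENNReal.ofReal x ^ n * a n = ∑' n, ENNReal.ofReal x ^ n * b n)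
    (hf : ∑' n, ENNReal.ofReal (1/2) ^ n * a n ≠ ⊤) : ∀ n, a n ≠ ⊤ ∧ a n = b n := by
  have key : ∀ a : ℕ → ℝ≥0∞, ∑' n, ENNReal.ofReal (1/2) ^ n * a n ≠ ⊤ →
      (∀ n, a n ≠ ⊤) ∧ ∀ x : ℝ, |x| ≤ 1/2 → Summable (fun n => x ^ n * (a n).toReal) := by
    intro a hf
    have hfin : ∀ n, a n ≠ ⊤ := by
      intro n hn
      apply ENNReal.ne_top_of_tsum_ne_top hf n
      rw [hn]
      apply ENNReal.mul_top
      apply pow_ne_zero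
      simp
    refine ⟨hfin, fun x hx => ?_⟩
    have hs := ENNReal.summable_toReal hf
    refine Summable.of_norm_bounded hs ?_
    intro n
    rw [ENNReal.toReal_mul, ENNReal.toReal_pow, ENNReal.toReal_ofReal (by norm_num), norm_mul,
      norm_pow, Real.norm_eq_abs, Real.norm_eq_abs, abs_of_nonneg ENNReal.toReal_nonneg]
    gcongr
  have hfb := hf
  rw [h _ (by norm_num) (by norm_num)] at hfb
  obtain ⟨ha, hsa⟩ := key a hf
  obtain ⟨hb, hsb⟩ := key b hfb
  set c : ℕ → ℝ := fun n => (a n).toReal - (b n).toReal with hc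
  set F : ℝ → ℝ := fun x => ∑' n, x ^ n * c n with hF
  have hsc : ∀ x : ℝ, |x| ≤ 1/2 → Summable (fun n => x ^ n * c n) := by
    intro x hx
    simpa [hc, mul_sub] using (hsa x hx).sub (hsb x hx)
  have hzero : ∀ x : ℝ, 0 < x → x ≤ 1/2 → F x = 0 := by
    intro x h0 h1
    have hx : |x| ≤ 1/2 := by rwa [abs_of_pos h0]
    have e : ∀ a : ℕ → ℝ≥0∞, (∀ n, a n ≠ ⊤) →
        (∑' n, ENNReal.ofReal x ^ n * a n).toReal = ∑' n, x ^ n * (a n).toReal := by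
      intro a ha
      rw [ENNReal.tsum_toReal_eq (fun n => ENNReal.mul_ne_top (by simp) (ha n))]
      simp [ENNReal.toReal_ofReal h0.le]
    have := congrArg ENNReal.toReal (h x h0.le (by linarith))
    rw [e a ha, e b hb] at this
    simp only [hF, hc, mul_sub]
    rw [(hsa x hx).tsum_sub (hsb x hx), this, sub_self]
  have hps : HasFPowerSeriesAt F (FormalMultilinearSeries.ofScalars ℝ c) 0 := by
    rw [hasFPowerSeriesAt_iff]
    have : ∀ᶠ z : ℝ in 𝓝 0, |z| < 1/2 := by
      have := Metric.ball_mem_nhds (0 : ℝ) (by norm_num : (0 : ℝ) < 1/2)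
      filter_upwards [this] with z hz
      simpa using hz
    filter_upwards [this] with z hz
    simp only [FormalMultilinearSeries.coeff_ofScalars, smul_eq_mul, zero_add]
    exact (hsc z hz.le).hasSum
  have hfr : ∃ᶠ z in 𝓝[≠] (0 : ℝ), F z = 0 := by
    have h1 : ∀ᶠ z in 𝓝[>] (0 : ℝ), F z = 0 := by
      filter_upwards [Ioc_mem_nhdsGT (by norm_num : (0 : ℝ) < 1/2)] with z hz
      exact hzero z hz.1 hz.2
    exact h1.frequently.filter_mono (nhdsWithin_mono _ (fun z hz => ne_of_gt hz))
  have hev := (hps.analyticAt.frequently_zero_iff_eventually_zero).1 hfr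
  have hp0 : FormalMultilinearSeries.ofScalars ℝ c = 0 :=
    (hps.congr hev).eq_zero
  intro n
  refine ⟨ha n, ?_⟩
  have : c n = 0 := by
    rw [← FormalMultilinearSeries.coeff_ofScalars (𝕜 := ℝ) (p := c) (n := n), hp0]
    simp [FormalMultilinearSeries.coeff]
  rw [← ENNReal.toReal_eq_toReal_iff' (ha n) (hb n)]
  simpa [hc, sub_eq_zero] using this

/-- nested sums with arbitrary weights -/
noncomputable def Q : List (ℕ → ℝ≥0∞) → ℕ → ℝ≥0∞
  | [], m => if m = 0 then 1 else 0
  | f :: fs, m => f m * ∑' j : ℕ, if j < m then Q fs j else 0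

def ok {l : ℕ} (n : Fin l → ℕ) : Prop :=
  (∀ i j : Fin l, i < j → n j < n i) ∧ (∀ i, 1 ≤ n i)

open Classical in
lemma Q_sum (fs : List (ℕ → ℝ≥0∞)) : ∀ p : ℕ → Prop, p 0 → (∀ i j, i ≤ j → p j → p i) →
    ∑' j, (if p j then Q fs j else 0) =
    ∑' n : Fin fs.length → ℕ, if ok n ∧ ∀ i, p (n i) then ∏ i, fs.get i (n i) else 0 := by
  induction fs with
  | nil =>
    intro p h0 _
    rw [tsum_eq_single 0]
    · rw [tsum_eq_single (fun i => i.elim0)]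
      · have : ok (fun i : Fin ([] : List (ℕ → ℝ≥0∞)).length => (i.elim0 : ℕ)) :=
          ⟨fun i => i.elim0, fun i => i.elim0⟩
        rw [if_pos h0, if_pos ⟨this, fun i => i.elim0⟩]
        simp [Q]
      · intro b hb; exact absurd (funext fun i => i.elim0) hb
    · intro j hj; simp [Q, hj]
  | cons f fs ih =>
    intro p h0 hp
    have e := (Fin.consEquiv (fun _ : Fin (fs.length + 1) => ℕ)).tsum_eq
      (fun n : Fin (fs.length + 1) → ℕ => if ok n ∧ ∀ i, p (n i) then
        ∏ i, (f :: fs).get i (n i) else 0)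
    refine Eq.trans ?_ e
    refine Eq.trans ?_ (ENNReal.tsum_prod (f := fun (m : ℕ) (n : Fin fs.length → ℕ) =>
      (fun n : Fin (fs.length + 1) → ℕ => if ok n ∧ ∀ i, p (n i) then
        ∏ i, (f :: fs).get i (n i) else 0) (Fin.cons m n))).symm
    refine tsum_congr fun m => ?_
    by_cases hm0 : m = 0
    · subst hm0
      have : ∀ n : Fin fs.length → ℕ, ¬ ok (Fin.cons 0 n : Fin (fs.length + 1) → ℕ) := by
        intro n h
        have := h.2 0
        simp at this
      simp [this, Q]
    by_cases hpm : p m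
    · rw [if_pos hpm]
      simp only [Q]
      have ih' := ih (fun j => j < m) (Nat.pos_of_ne_zero hm0)
        (fun i j h1 h2 => lt_of_le_of_lt h1 h2)
      rw [show (∑' j : ℕ, if j < m then Q fs j else 0) = _ from
        Eq.trans (tsum_congr fun j => by congr) ih', ← ENNReal.tsum_mul_left]
      refine tsum_congr fun n => ?_
      have hiff : (ok (Fin.cons m n : Fin (fs.length + 1) → ℕ) ∧
          ∀ i, p ((Fin.cons m n : Fin (fs.length + 1) → ℕ) i)) ↔ (ok n ∧ ∀ i, n i < m) := by
        simp only [ok, Fin.forall_fin_succ, Fin.cons_zero, Fin.cons_succ, Fin.succ_lt_succ_iff]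
        constructor
        · rintro ⟨⟨⟨⟨_, h1⟩, h2⟩, h3, h4⟩, h5, h6⟩
          exact ⟨⟨fun i => (h2 i).2, h4⟩, fun i => h1 i (Fin.succ_pos i)⟩
        · rintro ⟨⟨h1, h2⟩, h3⟩
          exact ⟨⟨⟨⟨fun h => absurd h (lt_irrefl _), fun i _ => h3 i⟩,
            fun i => ⟨fun h => absurd h (by simp), h1 i⟩⟩, Nat.one_le_iff_ne_zero.2 hm0, h2⟩, hpm,
            fun i => hp _ _ (h3 i).le hpm⟩
      by_cases hh : ok n ∧ ∀ i, n i < m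
      · rw [if_pos hh]
        rw [if_pos (hiff.2 hh)]
        exact (Fin.prod_univ_succ (fun i : Fin (fs.length + 1) =>
          (f :: fs).get i ((Fin.cons m n : Fin (fs.length + 1) → ℕ) i))).symm
      · rw [if_neg hh]
        rw [if_neg (fun h => hh (hiff.1 h)), mul_zero]
    · have : ∀ n : Fin fs.length → ℕ,
          ¬ (∀ i, p ((Fin.cons m n : Fin (fs.length + 1) → ℕ) i)) := by
        intro n h
        exact hpm (by simpa using h 0)
      simp [this, hpm]

lemma prod_tsum (l : ℕ) (g : Fin l → ℕ → ℝ≥0∞) :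
    ∏ i, ∑' c, g i c = ∑' c : Fin l → ℕ, ∏ i, g i (c i) := by
  induction l with
  | zero => simp
  | succ l ih =>
    rw [← (Fin.consEquiv (fun _ : Fin (l + 1) => ℕ)).tsum_eq, Fin.prod_univ_succ, ih]
    refine Eq.trans ?_ (ENNReal.tsum_prod (f := fun (m : ℕ) (n : Fin l → ℕ) =>
      ∏ i, g i ((Fin.cons m n : Fin (l + 1) → ℕ) i))).symm
    rw [← ENNReal.tsum_mul_right]
    refine tsum_congr fun m => ?_
    rw [← ENNReal.tsum_mul_left]
    refine tsum_congr fun n => ?_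
    rw [Fin.prod_univ_succ]
    simp

open Classical in
noncomputable def zE (l : ℕ) (k : Fin l → ℕ) : ℝ≥0∞ :=
  ∑' n : Fin l → ℕ, if ok n then ∏ i, iv (n i) ^ k i else 0

lemma mzv_eq (k : List ℕ) : mzv k = (zE k.length k.get).toReal := by
  unfold mzv zE
  rw [ENNReal.tsum_toReal_eq]
  · refine tsum_congr fun n => ?_
    by_cases h : ok n
    · rw [if_pos h]; refine (if_pos h).trans ?_; rw [ENNReal.toReal_prod]
      refine Finset.prod_congr rfl fun i _ => ?_
      rw [ENNReal.toReal_pow, iv, ENNReal.toReal_ofReal (by positivity), inv_pow]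
    · rw [if_neg h]; refine (if_neg h).trans ?_; simp
  · intro n
    split_ifs
    · exact ENNReal.prod_ne_top fun i _ => ENNReal.pow_ne_top (by simp [iv])
    · simp

lemma zE_ofFn (l : ℕ) (f : Fin l → ℕ) : mzv (List.ofFn f) = (zE l f).toReal := by
  rw [mzv_eq]
  have : ∀ (l' : ℕ) (h : l' = l) (g : Fin l' → ℕ), (∀ i, g i = f (Fin.cast h i)) →
      zE l' g = zE l f := by
    intro l' h g hg
    subst h
    congr 1
    funext i
    simpa using hg i
  rw [this _ (List.length_ofFn) _ (by intro i; simp; rfl)]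

/-- the weight for an entry `k` -/
noncomputable def wt (x : ℝ) (k : ℕ) (m : ℕ) : ℝ≥0∞ := iv m ^ (k - 1) * jx x m

lemma wt_eq {x : ℝ} (hx0 : 0 ≤ x) (hx : x < 1) (k m : ℕ) (hk : 1 ≤ k) (hm : 1 ≤ m) :
    wt x k m = ∑' c : ℕ, ENNReal.ofReal x ^ c * iv m ^ (k + c) := by
  have hm1 : (1 : ℝ) ≤ m := by exact_mod_cast hm
  obtain ⟨k, rfl⟩ := Nat.exists_eq_add_of_le hk
  have : ∀ c, ENNReal.ofReal x ^ c * iv m ^ (1 + k + c)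
      = iv m ^ k * (iv m * ENNReal.ofReal ((x / m) ^ c)) := by
    intro c
    rw [ENNReal.ofReal_pow (by positivity), div_eq_mul_inv, ENNReal.ofReal_mul hx0,
      ← iv, mul_pow]
    ring
  simp only [this]
  rw [ENNReal.tsum_mul_left, ENNReal.tsum_mul_left, wt, Nat.add_sub_cancel_left]
  congr 1
  have h0 : 0 ≤ x / m := by positivity
  have h1 : x / m < 1 := by rw [div_lt_one (by linarith)]; linarith
  rw [← ENNReal.ofReal_tsum_of_nonneg (fun n => by positivity)
    (summable_geometric_of_lt_one h0 h1), tsum_geometric_of_lt_one h0 h1, iv,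
    ← ENNReal.ofReal_mul (by positivity), jx]
  congr 1
  have : (m : ℝ) - x ≠ 0 := by linarith
  have : (m : ℝ) ≠ 0 := by linarith
  have : 1 - x / m ≠ 0 := by linarith
  field_simp

lemma Q_congr_len {l l' : ℕ} (h : l = l') (f : Fin l → ℕ → ℝ≥0∞) (g : Fin l' → ℕ → ℝ≥0∞)
    (hfg : ∀ i, f i = g (Fin.cast h i)) :
    (open Classical in ∑' n : Fin l → ℕ, if ok n then ∏ i, f i (n i) else 0) =
    (open Classical in ∑' n : Fin l' → ℕ, if ok n then ∏ i, g i (n i) else 0) := by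
  subst h
  have : f = g := by funext i; simpa using hfg i
  rw [this]

lemma gen_fun {x : ℝ} (hx0 : 0 ≤ x) (hx : x < 1) (k : List ℕ) (hk : ∀ a ∈ k, 1 ≤ a) :
    ∑' m, Q (k.map (wt x)) m =
    ∑' n, ENNReal.ofReal x ^ n * ∑ c ∈ Finset.Nat.antidiagonalTuple k.length n,
      zE k.length (fun i => k.get i + c i) := by
  classical
  have h1 := Q_sum (k.map (wt x)) (fun _ => True) trivial (fun _ _ _ _ => trivial)
  simp only [if_true, implies_true, and_true] at h1
  rw [h1, Q_congr_len (l' := k.length) (by simp) _ (fun i => wt x (k.get i)) (by intro i; simp)]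
  calc _ = ∑' n : Fin k.length → ℕ, ∑' c : Fin k.length → ℕ, ENNReal.ofReal x ^ (∑ i, c i) *
        (if ok n then ∏ i, iv (n i) ^ (k.get i + c i) else 0) := by
        refine tsum_congr fun n => ?_
        by_cases h : ok n
        · simp only [if_pos h]
          rw [Finset.prod_congr rfl (fun i _ => wt_eq hx0 hx (k.get i) (n i)
            (hk _ (List.get_mem _ _)) (h.2 i)), prod_tsum]
          refine tsum_congr fun c => ?_
          rw [Finset.prod_mul_distrib, Finset.prod_pow_eq_pow_sum]
        · simp [if_neg h]
    _ = ∑' c : Fin k.length → ℕ, ENNReal.ofReal x ^ (∑ i, c i) *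
          zE k.length (fun i => k.get i + c i) := by
        rw [ENNReal.tsum_comm]
        refine tsum_congr fun c => ?_
        rw [ENNReal.tsum_mul_left, zE]
    _ = _ := by
        rw [← (Finset.Nat.sigmaAntidiagonalTupleEquivTuple k.length).tsum_eq, ENNReal.tsum_sigma']
        refine tsum_congr fun n => ?_
        rw [tsum_fintype, Finset.mul_sum, ← Finset.sum_coe_sort (Finset.Nat.antidiagonalTuple _ n)]
        refine Finset.sum_congr rfl fun c _ => ?_
        have := Finset.Nat.mem_antidiagonalTuple.1 c.2
        simp only [Finset.Nat.sigmaAntidiagonalTupleEquivTuple, Equiv.coe_fn_mk]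
        rw [this]

/-- binary word of an index -/
def toWord : List ℕ → List Bool
  | [] => []
  | a :: t => List.replicate (a - 1) false ++ true :: toWord t

lemma W_toWord (x : ℝ) (k : List ℕ) : ∀ m, W x (toWord k) m = Q (k.map (wt x)) m := by
  induction k with
  | nil => intro m; simp [toWord, W, Q]
  | cons a t ih =>
    intro m
    simp only [toWord, W_repl, W, List.map_cons, Q, ih, wt]
    ring

end Ohno

namespace Ohno
open Filter Topology
open scoped ENNReal

/-- positions of `true` in a word, shifted by `o + 1` -/
def pos : ℕ → List Bool → List ℕ
  | _, [] => []
  | o, true :: w => (o + 1) :: pos (o + 1) w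
  | o, false :: w => pos (o + 1) w

lemma last_tail {b : Bool} {w : List Bool} (h : (b :: w).getLast? ≠ some false) :
    w.getLast? ≠ some false := by
  intro h'
  apply h
  rw [List.getLast?_cons, h']; rfl

lemma toWord_diff (w : List Bool) : ∀ o q : ℕ, q ≤ o → w.getLast? ≠ some false →
    (w = [] → q = o) →
    toWord (List.zipWith (· - ·) (pos o w) (q :: pos o w)) = List.replicate (o - q) false ++ w := by
  induction w with
  | nil => intro o q _ _ h; simp [pos, toWord, h rfl]
  | cons b w ih =>
    intro o q hq hl _
    cases b with
    | true =>
      simp only [pos, List.zipWith_cons_cons, toWord]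
      rw [ih (o + 1) (o + 1) le_rfl (last_tail hl) (fun _ => rfl)]
      rw [show o + 1 - q - 1 = o - q by omega]
      simp
    | false =>
      simp only [pos]
      rw [ih (o + 1) q (by omega) (last_tail hl) (by rintro rfl; simp at hl)]
      rw [show o + 1 - q = (o - q) + 1 by omega, List.replicate_succ']
      simp

lemma diff_pos (w : List Bool) : ∀ o q : ℕ, q ≤ o →
    ∀ a ∈ List.zipWith (· - ·) (pos o w) (q :: pos o w), 1 ≤ a := by
  induction w with
  | nil => intro o q _ a ha; simp [pos] at ha
  | cons b w ih =>
    intro o q hq a ha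
    cases b with
    | true =>
      simp only [pos, List.zipWith_cons_cons, List.mem_cons] at ha
      rcases ha with rfl | ha
      · omega
      · exact ih (o + 1) (o + 1) le_rfl a ha
    | false =>
      simp only [pos] at ha
      exact ih (o + 1) q (by omega) a ha

lemma filter_pos (f : ℕ → Bool) (w : List Bool) : ∀ o : ℕ,
    (∀ i, i < w.length → w[i]? = some (f (o + 1 + i))) →
    (List.range' (o + 1) w.length).filter f = pos o w := by
  induction w with
  | nil => intro o _; simp [pos]
  | cons b w ih =>
    intro o h
    have h0 := h 0 (by simp)
    simp at h0
    have h1 := ih (o + 1) (by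
      intro i hi
      have := h (i + 1) (by simpa using hi)
      rw [show o + 1 + 1 + i = o + 1 + (i + 1) by ring, ← this]
      simp)
    rw [List.length_cons, List.range'_succ, List.filter_cons, ← h0, h1]
    cases b <;> simp [pos]

lemma partialSums_cons (a : ℕ) (t : List ℕ) :
    partialSums (a :: t) = a :: (partialSums t).map (a + ·) := by
  simp [partialSums, List.range_succ_eq_map, Function.comp_def]

lemma length_toWord (k : List ℕ) (hk : ∀ a ∈ k, 1 ≤ a) : (toWord k).length = k.sum := by
  induction k with
  | nil => rfl
  | cons a t ih =>
    have := hk a (by simp)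
    simp only [toWord, List.length_append, List.length_replicate, List.length_cons, List.sum_cons]
    rw [ih (fun b hb => hk b (by simp [hb]))]
    omega

lemma zero_notMem (k : List ℕ) (hk : ∀ a ∈ k, 1 ≤ a) : 0 ∉ partialSums k := by
  cases k with
  | nil => simp [partialSums]
  | cons a t =>
    have := hk a (by simp)
    rw [partialSums_cons]
    simp
    omega

lemma mem_partialSums (k : List ℕ) (hk : ∀ a ∈ k, 1 ≤ a) :
    ∀ p, p + 1 ∈ partialSums k ↔ (toWord k)[p]? = some true := by
  induction k with
  | nil => intro p; simp [partialSums, toWord]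
  | cons a t ih =>
    intro p
    have ha := hk a (by simp)
    have hz := zero_notMem t (fun b hb => hk b (by simp [hb]))
    replace ih := ih (fun b hb => hk b (by simp [hb]))
    rw [partialSums_cons, toWord]
    simp only [List.mem_cons, List.mem_map]
    rcases lt_trichotomy p (a - 1) with h | h | h
    · rw [List.getElem?_append_left (by simpa using h)]
      simp only [List.getElem?_replicate, h, if_true]
      constructor
      · rintro (h' | ⟨b, hb, h'⟩) <;> omega
      · simp
    · rw [List.getElem?_append_right (by simp; omega)]
      subst h
      simp
      left; omega
    · rw [List.getElem?_append_right (by simp; omega)]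
      simp only [List.length_replicate]
      rw [show p - (a - 1) = (p - a) + 1 by omega, List.getElem?_cons_succ, ← ih]
      constructor
      · rintro (h' | ⟨b, hb, h'⟩)
        · omega
        · rwa [show p - a + 1 = b by omega]
      · intro h'
        exact Or.inr ⟨_, h', by omega⟩

lemma dual_eq (k : List ℕ) (hk : ∀ a ∈ k, 1 ≤ a) :
    dualSeq k = unPartial (pos 0 ((toWord k).map not).reverse) := by
  unfold dualSeq
  simp only []
  congr 1
  have hlen := length_toWord k hk
  rw [← filter_pos (fun m => decide (m ∉ (partialSums k).reverse.map fun a => k.sum + 1 - a))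
    ((toWord k).map not).reverse 0]
  · simp only [List.length_reverse, List.length_map, hlen]
    rw [List.range'_eq_map_range]
    simp [add_comm]
  · intro i hi
    simp only [List.length_reverse, List.length_map] at hi
    rw [List.getElem?_reverse (by simpa using hi)]
    simp only [List.length_map, List.getElem?_map]
    have hp := mem_partialSums k hk ((toWord k).length - 1 - i)
    have hlt : (toWord k).length - 1 - i < (toWord k).length := by omega
    rw [List.getElem?_eq_getElem hlt] at hp ⊢
    simp only [Option.some.injEq] at hp
    simp only [Option.map_some, Option.some.injEq]
    have hiff : (0 + 1 + i ∈ (partialSums k).reverse.map fun a => k.sum + 1 - a) ↔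
        (toWord k)[(toWord k).length - 1 - i] = true := by
      rw [← hp]
      simp only [List.mem_map, List.mem_reverse]
      constructor
      · rintro ⟨a, ha, h⟩
        rwa [show (toWord k).length - 1 - i + 1 = a by omega]
      · intro h
        exact ⟨_, h, by omega⟩
    rw [decide_not]
    congr 1
    rw [Bool.eq_iff_iff, decide_eq_true_iff, hiff]

lemma toWord_last (k : List ℕ) (hk : k ≠ []) : (toWord k).getLast? = some true := by
  induction k with
  | nil => exact absurd rfl hk
  | cons a t ih =>
    simp only [toWord, List.getLast?_append, List.getLast?_cons]
    by_cases ht : t = []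
    · subst ht; simp [toWord]
    · simp [ih ht]

lemma toWord_dual (s : List ℕ) (hpos : ∀ a ∈ s, 1 ≤ a) (hh : (toWord s).head? = some false) :
    toWord (dualSeq s) = ((toWord s).map not).reverse := by
  rw [dual_eq s hpos, unPartial, toWord_diff _ 0 0 le_rfl]
  · simp
  · rw [List.getLast?_reverse, List.head?_map, hh]; simp
  · intro _; rfl

lemma sum_toReal {ι : Type*} (S : Finset ι) (f : ι → ℝ≥0∞) (h : ∑ c ∈ S, f c ≠ ⊤) :
    ∑ c ∈ S, (f c).toReal = (∑ c ∈ S, f c).toReal := by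
  rw [ENNReal.toReal_sum]
  exact ENNReal.sum_ne_top.1 h

lemma dual_pos (s : List ℕ) (hpos : ∀ a ∈ s, 1 ≤ a) : ∀ a ∈ dualSeq s, 1 ≤ a := by
  rw [dual_eq s hpos]
  exact diff_pos _ 0 0 le_rfl

end Ohno


/-- **Ohno's relation (Theorem 5.6).**  Let `s = (k₁,…,k_l)` be admissible with dual
`τ(s) = (k'₁,…,k'_{l'})`.  Then for every `n ≥ 0`,
`∑_{c₁+⋯+c_l = n} ζ(k₁+c₁,…,k_l+c_l) = ∑_{d₁+⋯+d_{l'} = n} ζ(k'₁+d₁,…,k'_{l'}+d_{l'})`,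
the sums being over tuples of nonnegative integers. -/
theorem ohno_relation (s : List ℕ)
    (hpos : ∀ a ∈ s, 1 ≤ a) (hadm : ∃ a t, s = a :: t ∧ 2 ≤ a) (n : ℕ) :
    ∑ c ∈ Finset.Nat.antidiagonalTuple s.length n,
        mzv (List.ofFn fun i => s.get i + c i) =
      ∑ d ∈ Finset.Nat.antidiagonalTuple (dualSeq s).length n,
        mzv (List.ofFn fun j => (dualSeq s).get j + d j) := by
  have hs : s ≠ [] := by obtain ⟨a, t, rfl, _⟩ := hadm; simp
  have hh : (Ohno.toWord s).head? = some false := by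
    obtain ⟨a, t, rfl, ha⟩ := hadm
    obtain ⟨b, rfl⟩ := Nat.exists_eq_add_of_le' ha
    simp [Ohno.toWord, List.replicate_succ]
  have hl := Ohno.toWord_last s hs
  have gen : ∀ k : List ℕ, (∀ a ∈ k, 1 ≤ a) → ∀ x : ℝ, 0 ≤ x → x < 1 →
      ∑' m, Ohno.W x (Ohno.toWord k) m =
      ∑' n, ENNReal.ofReal x ^ n * ∑ c ∈ Finset.Nat.antidiagonalTuple k.length n,
        Ohno.zE k.length (fun i => k.get i + c i) := by
    intro k hk x h0 h1
    rw [← Ohno.gen_fun h0 h1 k hk]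
    exact tsum_congr (Ohno.W_toWord x k)
  have key := Ohno.coeff_unique
    (fun n => ∑ c ∈ Finset.Nat.antidiagonalTuple s.length n,
        Ohno.zE s.length (fun i => s.get i + c i))
    (fun n => ∑ c ∈ Finset.Nat.antidiagonalTuple (dualSeq s).length n,
        Ohno.zE (dualSeq s).length (fun i => (dualSeq s).get i + c i))
    (by
      intro x h0 h1
      rw [← gen s hpos x h0 h1, ← gen (dualSeq s) (Ohno.dual_pos s hpos) x h0 h1,
        Ohno.toWord_dual s hpos hh]
      exact Ohno.word_dual h0 h1 _ hl hh)
    (by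
      rw [← gen s hpos (1/2) (by norm_num) (by norm_num)]
      exact Ohno.finite_half _ hl hh) n
  obtain ⟨hfin, heq⟩ := key
  have hfin' := hfin
  beta_reduce at heq hfin
  beta_reduce at hfin'
  rw [heq] at hfin'
  simp only [Ohno.zE_ofFn]
  rw [Ohno.sum_toReal _ _ hfin, Ohno.sum_toReal _ _ hfin', heq]
end

section
/- (Corollary 5.5, explicit form.) For all integers n, m ≥ 1: ζ(n+2, 1^{m−1}) + ∑_{i=1}^{m−1} ζ(2, 1^{m−1−i}, n+1, 1^{i−1}) = ζ(m+2, 1^{n−1}) + ∑_{i=1}^{n−1} ζ(2, 1^{n−1−i}, m+1, 1^{i−1}), where 1^c denotes c consecutive entries equal to 1 (so, e.g., ζ(n+2, 1^{m−1}) = ζ(n+2, 1, …, 1) with m−1 ones). -/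
open scoped ENNReal

namespace CycSum

/-- Reciprocal with the convention that the value at zero is zero. -/
noncomputable def iv (p : ℕ) : ℝ≥0∞ := if p = 0 then 0 else (p : ℝ≥0∞)⁻¹

/-- Indicator of `r < p`. -/
noncomputable def lt (r p : ℕ) : ℝ≥0∞ := if r < p then 1 else 0

/-- Kernel of a word; `true` is the letter `x`, `false` the letter `y`. -/
noncomputable def M : List Bool → ℕ → ℕ → ℝ≥0∞
  | [], p, c => if p = c then 1 else 0
  | true :: w, p, c => iv p * M w p c
  | false :: w, p, c => iv p * ∑' r, lt r p * M w r c

/-- Zeta value of a word. -/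
noncomputable def Z (w : List Bool) : ℝ≥0∞ := ∑' p, M w p 0

/-- The cyclic sum of a word. -/
noncomputable def tr (w : List Bool) : ℝ≥0∞ := ∑' p, ∑' c, M w p c * iv (p - c)

lemma iv_zero : iv 0 = 0 := by simp [iv]

lemma iv_ofReal (p : ℕ) : iv p = ENNReal.ofReal ((p : ℝ)⁻¹) := by
  unfold iv
  split_ifs with h
  · simp [h]
  · rw [ENNReal.ofReal_inv_of_pos (by positivity), ENNReal.ofReal_natCast]

lemma M_snoc_x (w : List Bool) (p c : ℕ) : M (w ++ [true]) p c = M w p c * iv c := by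
  induction w generalizing p with
  | nil =>
    simp only [List.nil_append, M]
    split_ifs with h
    · simp [h]
    · simp
  | cons a w ih =>
    cases a
    · simp only [List.cons_append, M, ih, ← mul_assoc, ENNReal.tsum_mul_right]
    · simp only [List.cons_append, M, ih, ← mul_assoc]

lemma M_snoc_y (w : List Bool) (p c : ℕ) :
    M (w ++ [false]) p c = ∑' d, M w p d * (iv d * lt c d) := by
  induction w generalizing p with
  | nil =>
    simp only [List.nil_append, M]
    have e1 : (∑' r, lt r p * (if r = c then (1 : ℝ≥0∞) else 0)) = lt c p := by
      rw [tsum_eq_single c (by intro b hb; simp [hb])]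
      simp
    have e2 : (∑' d, (if p = d then (1 : ℝ≥0∞) else 0) * (iv d * lt c d)) = iv p * lt c p := by
      rw [tsum_eq_single p (by intro b hb; simp [hb.symm])]
      simp
    rw [e1, e2]
  | cons a w ih =>
    cases a
    · simp only [List.cons_append, M, ih, ← ENNReal.tsum_mul_left, ← ENNReal.tsum_mul_right]
      rw [ENNReal.tsum_comm]
      simp only [mul_assoc]
    · simp only [List.cons_append, M, ih, ← ENNReal.tsum_mul_left, mul_assoc]

lemma M_lt (w : List Bool) (p c : ℕ) (h : p < c) : M w p c = 0 := by
  induction w generalizing p with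
  | nil => simp [M, h.ne]
  | cons a w ih =>
    cases a
    · simp only [M, mul_eq_zero, ENNReal.tsum_eq_zero]
      right
      intro r
      by_cases hr : r < p
      · right; exact ih r (hr.trans h)
      · left; simp [lt, hr]
    · simp [M, ih p h]

lemma M_le (w : List Bool) (hw : false ∈ w) (p c : ℕ) (h : p ≤ c) : M w p c = 0 := by
  induction w generalizing p with
  | nil => simp at hw
  | cons a w ih =>
    cases a
    · simp only [M, mul_eq_zero, ENNReal.tsum_eq_zero]
      right
      intro r
      by_cases hr : r < p
      · right; exact M_lt w r c (by omega)
      · left; simp [lt, hr]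
    · simp at hw
      simp [M, ih hw p h]

lemma Z_snoc_x (w : List Bool) : Z (w ++ [true]) = 0 := by
  simp [Z, M_snoc_x, iv_zero]

lemma tr_x (w : List Bool) (hw : false ∈ w) :
    tr (true :: w) + Z (true :: (w ++ [false])) = tr (w ++ [true]) + Z (true :: true :: w) := by
  have h1 : Z (true :: (w ++ [false])) = ∑' p, ∑' c, M w p c * (iv p * iv c) := by
    unfold Z
    congr 1; ext p
    simp only [M, M_snoc_y, ← ENNReal.tsum_mul_left]
    congr 1; ext c
    rcases Nat.eq_zero_or_pos c with rfl | hc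
    · simp [iv_zero]
    · simp only [lt, hc, if_true]; ring
  have h2 : Z (true :: true :: w) =
      ∑' p, ∑' c, M w p c * (if c = 0 then iv p * iv p else 0) := by
    unfold Z
    congr 1; ext p
    rw [tsum_eq_single 0 (by intro b hb; simp [hb])]
    simp only [M, if_true]; ring
  rw [h1, h2]
  unfold tr
  rw [← ENNReal.tsum_add, ← ENNReal.tsum_add]
  congr 1; ext p
  rw [← ENNReal.tsum_add, ← ENNReal.tsum_add]
  congr 1; ext c
  simp only [M, M_snoc_x]
  rcases Nat.lt_or_ge c p with h | h
  · have : iv p * iv (p - c) + iv p * iv c =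
        iv c * iv (p - c) + (if c = 0 then iv p * iv p else 0) := by
      rcases Nat.eq_zero_or_pos c with rfl | hc
      · simp [iv_zero]
      · rw [if_neg hc.ne', add_zero]
        have hc' : (0 : ℝ) < c := by exact_mod_cast hc
        have hp : (c : ℝ) < p := by exact_mod_cast h
        have hp0 : (0 : ℝ) < p := by linarith
        have hpc : (0 : ℝ) < p - c := by linarith
        simp only [iv_ofReal, Nat.cast_sub h.le]
        rw [← ENNReal.ofReal_mul (by positivity), ← ENNReal.ofReal_mul (by positivity),
          ← ENNReal.ofReal_mul (by positivity), ← ENNReal.ofReal_add (by positivity) (by positivity)]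
        congr 1
        field_simp
        ring
    calc _ = M w p c * (iv p * iv (p - c) + iv p * iv c) := by ring
      _ = _ := by rw [this]; ring
  · simp [M_le w hw p c h]

/-- Telescoping sums. -/
lemma telescope (f : ℕ → ℝ) (g : ℕ → ℝ≥0∞) (r : ℕ)
    (hg : ∀ p, r ≤ p → 0 ≤ f p - f (p + 1) ∧ g (p + 1) = ENNReal.ofReal (f p - f (p + 1)))
    (hf : Filter.Tendsto f Filter.atTop (nhds 0)) :
    ∑' p, lt r p * g p = ENNReal.ofReal (f r) := by
  have h1 : ∑' p, lt r p * g p = ∑' k, ENNReal.ofReal (f (k + r) - f (k + r + 1)) := by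
    have e : (∑ i ∈ Finset.range (r + 1), lt r i * g i) +
        (∑' k, lt r (k + (r + 1)) * g (k + (r + 1))) = ∑' p, lt r p * g p :=
      Summable.sum_add_tsum_nat_add' (f := fun p => lt r p * g p) (k := r + 1) ENNReal.summable
    have e0 : (∑ i ∈ Finset.range (r + 1), lt r i * g i) = 0 := by
      apply Finset.sum_eq_zero
      intro i hi
      have := Finset.mem_range.1 hi
      simp [lt, show ¬ r < i by omega]
    rw [← e, e0, zero_add]
    apply tsum_congr
    intro k
    rw [← (hg (k + r) (by omega)).2]
    have : lt r (k + (r + 1)) = 1 := by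
      unfold lt
      rw [if_pos (by omega)]
    rw [this, one_mul, add_assoc]
  have h2 : HasSum (fun k => f (k + r) - f (k + r + 1)) (f r) := by
    rw [hasSum_iff_tendsto_nat_of_nonneg (fun k => (hg (k + r) (by omega)).1)]
    have : ∀ n, ∑ i ∈ Finset.range n, (f (i + r) - f (i + r + 1)) = f r - f (n + r) := by
      intro n
      have := Finset.sum_range_sub' (fun i => f (i + r)) n
      simp only [zero_add] at this
      rw [← this]
      apply Finset.sum_congr rfl
      intro i _
      rw [show i + 1 + r = i + r + 1 by omega]
    simp only [this]
    have h3 : Filter.Tendsto (fun n => f (n + r)) Filter.atTop (nhds 0) :=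
      (Filter.tendsto_add_atTop_iff_nat r).2 hf
    simpa using (tendsto_const_nhds (x := f r)).sub h3
  rw [h1, ← ENNReal.ofReal_tsum_of_nonneg (fun k => (hg (k + r) (by omega)).1) h2.summable,
    h2.tsum_eq]

lemma sum_lt (d : ℕ) (g : ℕ → ℝ≥0∞) : ∑' c, lt c d * g c = ∑ c ∈ Finset.range d, g c := by
  rw [tsum_eq_sum (s := Finset.range d)]
  · apply Finset.sum_congr rfl
    intro c hc
    simp [lt, Finset.mem_range.1 hc]
  · intro c hc
    simp only [Finset.mem_range] at hc
    simp [lt, hc]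

lemma key_y (r c : ℕ) (hc : 0 < c) (hr : c ≤ r) :
    ∑' p, lt r p * (iv p * iv (p - c)) = iv c * ∑' d, lt d c * iv (r - d) := by
  rw [sum_lt]
  have hc' : (0 : ℝ) < c := by exact_mod_cast hc
  have hR : iv c * ∑ d ∈ Finset.range c, iv (r - d) =
      ENNReal.ofReal ((c : ℝ)⁻¹ * ∑ d ∈ Finset.range c, ((r : ℝ) - d)⁻¹) := by
    rw [ENNReal.ofReal_mul (by positivity), iv_ofReal, ENNReal.ofReal_sum_of_nonneg]
    · congr 1
      apply Finset.sum_congr rfl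
      intro d hd
      have := Finset.mem_range.1 hd
      rw [iv_ofReal, Nat.cast_sub (by omega)]
    · intro d hd
      have := Finset.mem_range.1 hd
      have : (d : ℝ) ≤ r := by exact_mod_cast (by omega)
      exact inv_nonneg.2 (by linarith)
  rw [hR]
  apply telescope (fun p => (c : ℝ)⁻¹ * ∑ d ∈ Finset.range c, ((p : ℝ) - d)⁻¹)
  · intro p hp
    have hpc : (c : ℝ) ≤ p := by exact_mod_cast hr.trans hp
    have key : (c : ℝ)⁻¹ * ∑ d ∈ Finset.range c, ((p : ℝ) - d)⁻¹ -
        (c : ℝ)⁻¹ * ∑ d ∈ Finset.range c, (((p + 1 : ℕ) : ℝ) - d)⁻¹ =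
        ((p + 1 : ℕ) : ℝ)⁻¹ * (((p + 1 - c : ℕ) : ℝ))⁻¹ := by
      rw [← mul_sub, ← Finset.sum_sub_distrib]
      have h4 := Finset.sum_range_sub (fun d : ℕ => ((p : ℝ) + 1 - d)⁻¹) c
      have h5 : ∑ d ∈ Finset.range c, (((p : ℝ) - d)⁻¹ - (((p + 1 : ℕ) : ℝ) - d)⁻¹) =
          ∑ i ∈ Finset.range c, (((p : ℝ) + 1 - (i + 1 : ℕ))⁻¹ - ((p : ℝ) + 1 - i)⁻¹) := by
        apply Finset.sum_congr rfl
        intro d _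
        push_cast
        congr 2; ring
      rw [h5, h4, Nat.cast_sub (by omega)]
      push_cast
      have : (0 : ℝ) < p + 1 - c := by linarith
      have : (0 : ℝ) < p + 1 := by linarith
      rw [sub_zero]
      field_simp
      ring
    rw [key]
    refine ⟨by positivity, ?_⟩
    rw [ENNReal.ofReal_mul (by positivity), iv_ofReal, iv_ofReal]
  · rw [show (0 : ℝ) = (c : ℝ)⁻¹ * ∑ d ∈ Finset.range c, (0 : ℝ) by simp]
    apply Filter.Tendsto.const_mul
    apply tendsto_finsetSum
    intro d _
    apply Filter.Tendsto.inv_tendsto_atTop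
    exact Filter.tendsto_atTop_add_const_right _ _ tendsto_natCast_atTop_atTop

lemma tr_y (w : List Bool) :
    tr (false :: w) = tr (w ++ [false]) + Z (true :: false :: w) := by
  have h1 : tr (false :: w) = ∑' r, ∑' c, M w r c * ∑' p, lt r p * (iv p * iv (p - c)) := by
    unfold tr
    simp only [M, ← ENNReal.tsum_mul_left, ← ENNReal.tsum_mul_right]
    calc _ = ∑' p, ∑' r, ∑' c, iv p * (lt r p * M w r c) * iv (p - c) := by
          congr 1; ext p; rw [ENNReal.tsum_comm]
      _ = ∑' r, ∑' p, ∑' c, iv p * (lt r p * M w r c) * iv (p - c) := ENNReal.tsum_comm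
      _ = _ := by
          congr 1; ext r; rw [ENNReal.tsum_comm]
          congr 1; ext c; congr 1; ext p; ring
  have h2 : tr (w ++ [false]) = ∑' r, ∑' c, M w r c * (iv c * ∑' d, lt d c * iv (r - d)) := by
    unfold tr
    simp only [M_snoc_y, ← ENNReal.tsum_mul_left, ← ENNReal.tsum_mul_right]
    congr 1; ext r
    rw [ENNReal.tsum_comm]
    congr 1; ext c; congr 1; ext p; ring
  have h3 : Z (true :: false :: w) = ∑' r, ∑' c, M w r c *
      (if c = 0 then ∑' p, lt r p * (iv p * iv p) else 0) := by
    unfold Z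
    simp only [M, ← ENNReal.tsum_mul_left]
    rw [ENNReal.tsum_comm]
    congr 1; ext r
    rw [tsum_eq_single (f := fun c => M w r c *
      (if c = 0 then ∑' p, lt r p * (iv p * iv p) else 0)) 0 (by intro b hb; simp [hb])]
    simp only [if_true, ← ENNReal.tsum_mul_left]
    congr 1; ext p; ring
  rw [h1, h2, h3, ← ENNReal.tsum_add]
  congr 1; ext r
  rw [← ENNReal.tsum_add]
  congr 1; ext c
  rw [← mul_add]
  rcases Nat.eq_zero_or_pos c with rfl | hc
  · simp [iv_zero]
  rcases Nat.lt_or_ge r c with h | h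
  · simp [M_lt w r c h]
  · rw [key_y r c hc h, if_neg hc.ne', add_zero]

/-! ### Duality by connected sums -/

/-- The connector. -/
noncomputable def Cn (p q : ℕ) : ℝ≥0∞ :=
  ENNReal.ofReal ((p.factorial * q.factorial : ℝ) / (p + q).factorial)

lemma Cn_comm (p q : ℕ) : Cn p q = Cn q p := by
  unfold Cn
  rw [add_comm q p, mul_comm]

lemma Cn_zero (p : ℕ) : Cn p 0 = 1 := by
  unfold Cn
  have : (p.factorial : ℝ) ≠ 0 := by positivity
  simp [this]

lemma conn (r q : ℕ) (hq : 0 < q) :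
    ∑' p, lt r p * (iv p * Cn p q) = iv q * Cn r q := by
  have hR : iv q * Cn r q = ENNReal.ofReal
      ((q : ℝ)⁻¹ * ((r.factorial * q.factorial : ℝ) / (r + q).factorial)) := by
    rw [ENNReal.ofReal_mul (by positivity), iv_ofReal, Cn]
  rw [hR]
  apply telescope (fun r => (q : ℝ)⁻¹ * ((r.factorial * q.factorial : ℝ) / (r + q).factorial))
  · intro p _
    have key : (q : ℝ)⁻¹ * ((p.factorial * q.factorial : ℝ) / (p + q).factorial) -
        (q : ℝ)⁻¹ * (((p + 1).factorial * q.factorial : ℝ) / (p + 1 + q).factorial) =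
        ((p + 1 : ℕ) : ℝ)⁻¹ *
          (((p + 1).factorial * q.factorial : ℝ) / (p + 1 + q).factorial) := by
      rw [show p + 1 + q = (p + q) + 1 by ring, Nat.factorial_succ, Nat.factorial_succ]
      have h1 : ((p + q).factorial : ℝ) ≠ 0 := by positivity
      have h2 : (q : ℝ) ≠ 0 := by positivity
      have h3 : (p : ℝ) + q + 1 ≠ 0 := by positivity
      have h4 : (p : ℝ) + 1 ≠ 0 := by positivity
      push_cast
      field_simp
      ring
    simp only [key]
    refine ⟨by positivity, ?_⟩
    rw [ENNReal.ofReal_mul (by positivity), iv_ofReal, Cn]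
  · rw [show (0 : ℝ) = (q : ℝ)⁻¹ * 0 by simp]
    apply Filter.Tendsto.const_mul
    refine squeeze_zero (g := fun n : ℕ => (q.factorial : ℝ) * (1 / ((n : ℝ) + 1)))
      (fun n => by positivity) ?_ ?_
    · intro n
      have h1 : ((n + 1).factorial : ℝ) ≤ (n + q).factorial := by
        exact_mod_cast Nat.factorial_le (by omega)
      have h2 : (0 : ℝ) < (n + 1).factorial := by positivity
      calc (n.factorial * q.factorial : ℝ) / (n + q).factorial
          ≤ (n.factorial * q.factorial : ℝ) / (n + 1).factorial := by gcongr
        _ = (q.factorial : ℝ) * (1 / ((n : ℝ) + 1)) := by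
          rw [Nat.factorial_succ]
          have : (n.factorial : ℝ) ≠ 0 := by positivity
          push_cast
          field_simp
    · simpa using (tendsto_one_div_add_atTop_nhds_zero_nat (𝕜 := ℝ)).const_mul (q.factorial : ℝ)

/-- Connected sum of two words. -/
noncomputable def Z2 (u v : List Bool) : ℝ≥0∞ := ∑' p, ∑' q, M u p 0 * M v q 0 * Cn p q

lemma Z2_comm (u v : List Bool) : Z2 u v = Z2 v u := by
  unfold Z2
  rw [ENNReal.tsum_comm]
  refine tsum_congr fun p => tsum_congr fun q => ?_
  rw [Cn_comm]; ring

lemma M_zero (v : List Bool) (hv : v ≠ []) (c : ℕ) : M v 0 c = 0 := by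
  cases v with
  | nil => exact absurd rfl hv
  | cons a v => cases a <;> simp [M, iv_zero]

lemma Z2_y (u v : List Bool) (hv : v ≠ []) : Z2 (false :: u) v = Z2 u (true :: v) := by
  have h1 : Z2 (false :: u) v =
      ∑' r, ∑' q, M u r 0 * M v q 0 * ∑' p, lt r p * (iv p * Cn p q) := by
    unfold Z2
    simp only [M, ← ENNReal.tsum_mul_left, ← ENNReal.tsum_mul_right]
    calc _ = ∑' p, ∑' r, ∑' q, iv p * (lt r p * M u r 0) * M v q 0 * Cn p q :=
          tsum_congr fun p => ENNReal.tsum_comm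
      _ = ∑' r, ∑' p, ∑' q, iv p * (lt r p * M u r 0) * M v q 0 * Cn p q := ENNReal.tsum_comm
      _ = _ := by
          refine tsum_congr fun r => ?_
          rw [ENNReal.tsum_comm]
          refine tsum_congr fun q => tsum_congr fun p => ?_
          ring
  rw [h1]
  unfold Z2
  refine tsum_congr fun r => tsum_congr fun q => ?_
  rcases Nat.eq_zero_or_pos q with rfl | hq
  · simp [M_zero v hv, M]
  · rw [conn r q hq]
    simp only [M]
    ring

lemma Z2_x (u v : List Bool) (hu : u ≠ []) : Z2 (true :: u) v = Z2 u (false :: v) := by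
  rw [Z2_comm u, Z2_y v u hu, Z2_comm]

lemma Z2_nil (u : List Bool) : Z2 u [] = Z u := by
  unfold Z2 Z
  refine tsum_congr fun p => ?_
  rw [tsum_eq_single 0 (by intro b hb; simp [M, hb])]
  simp [M, Cn_zero]

/-- Dual word. -/
def dual (w : List Bool) : List Bool := (w.map not).reverse

lemma Z2_move (u v : List Bool) (hv : v ≠ []) :
    Z2 (u ++ [false]) v = Z2 [] (true :: (dual u ++ v)) := by
  induction u generalizing v with
  | nil => simpa [dual] using Z2_y [] v hv
  | cons a u ih =>
    have e : dual (a :: u) ++ v = dual u ++ ((!a) :: v) := by simp [dual]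
    rw [e, ← ih _ (by simp)]
    cases a
    · exact Z2_y _ _ hv
    · exact Z2_x _ _ (by simp)

lemma duality (u : List Bool) :
    Z (true :: (u ++ [false])) = Z (true :: (dual u ++ [false])) := by
  rw [← Z2_nil, Z2_x _ _ (by simp), Z2_move _ _ (by simp), Z2_comm, Z2_nil]

/-! ### The cyclic sum -/

/-- A power of `x`. -/
def X (n : ℕ) : List Bool := List.replicate n true

/-- A power of `y`. -/
def Y (n : ℕ) : List Bool := List.replicate n false

lemma X_succ (n : ℕ) : X (n + 1) = true :: X n := rfl
lemma Y_succ (n : ℕ) : Y (n + 1) = false :: Y n := rfl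
lemma X_succ' (n : ℕ) : X (n + 1) = X n ++ [true] := List.replicate_succ'
lemma Y_succ' (n : ℕ) : Y (n + 1) = Y n ++ [false] := List.replicate_succ'
lemma dual_X (n : ℕ) : dual (X n) = Y n := by simp [dual, X, Y]
lemma dual_Y (n : ℕ) : dual (Y n) = X n := by simp [dual, X, Y]
lemma dual_append (u v : List Bool) : dual (u ++ v) = dual v ++ dual u := by simp [dual]

lemma phase1 (m a b : ℕ) (hm : 1 ≤ m) :
    tr (X a ++ (Y m ++ X b)) +
      ∑ j ∈ Finset.range a, Z (X (a - j) ++ (Y m ++ (X (b + j) ++ [false]))) =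
    tr (Y m ++ X (b + a)) +
      ∑ j ∈ Finset.range a, Z (X (a - j + 1) ++ (Y m ++ X (b + j))) := by
  induction a generalizing b with
  | zero => simp [X]
  | succ a ih =>
    have h := tr_x (X a ++ (Y m ++ X b)) (by
      obtain ⟨m, rfl⟩ : ∃ k, m = k + 1 := ⟨m - 1, by omega⟩
      simp [Y_succ])
    have ihb := ih (b + 1)
    rw [Finset.sum_range_succ', Finset.sum_range_succ']
    simp only [Nat.add_sub_add_right, Nat.sub_zero, add_zero]
    simp only [X_succ a, X_succ (a + 1), List.cons_append]
    simp only [List.append_assoc, ← X_succ'] at h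
    have e : ∀ j, b + (j + 1) = b + 1 + j := fun j => by ring
    have e1 : ∑ j ∈ Finset.range a, Z (X (a - j) ++ (Y m ++ (X (b + (j + 1)) ++ [false]))) =
        ∑ j ∈ Finset.range a, Z (X (a - j) ++ (Y m ++ (X (b + 1 + j) ++ [false]))) :=
      Finset.sum_congr rfl fun j _ => by rw [e j]
    have e2 : ∑ j ∈ Finset.range a, Z (X (a - j + 1) ++ (Y m ++ X (b + (j + 1)))) =
        ∑ j ∈ Finset.range a, Z (X (a - j + 1) ++ (Y m ++ X (b + 1 + j))) :=
      Finset.sum_congr rfl fun j _ => by rw [e j]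
    simp only [X_succ, List.cons_append] at e1 e2 ihb h ⊢
    rw [e1, e2, show b + (a + 1) = b + 1 + a by ring]
    rw [add_comm (∑ j ∈ Finset.range a, Z (X (a - j) ++ (Y m ++ (X (b + 1 + j) ++ [false])))),
      ← add_assoc, h, add_right_comm, ihb, add_assoc]

lemma phase2 (n a b : ℕ) :
    tr (Y a ++ (X n ++ Y b)) = tr (X n ++ Y (b + a)) +
      ∑ j ∈ Finset.range a, Z (true :: (Y (a - j) ++ (X n ++ Y (b + j)))) := by
  induction a generalizing b with
  | zero => simp [Y]
  | succ a ih =>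
    have h := tr_y (Y a ++ (X n ++ Y b))
    have ihb := ih (b + 1)
    rw [Finset.sum_range_succ']
    simp only [Nat.add_sub_add_right, Nat.sub_zero, add_zero]
    simp only [Y_succ a, List.cons_append]
    simp only [List.append_assoc, ← Y_succ'] at h
    have e : ∀ j, b + (j + 1) = b + 1 + j := fun j => by ring
    have e1 : ∑ j ∈ Finset.range a, Z (true :: (Y (a - j) ++ (X n ++ Y (b + (j + 1))))) =
        ∑ j ∈ Finset.range a, Z (true :: (Y (a - j) ++ (X n ++ Y (b + 1 + j)))) :=
      Finset.sum_congr rfl fun j _ => by rw [e j]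
    rw [e1, show b + (a + 1) = b + 1 + a by ring]
    rw [h, ihb, add_assoc]

/-- The sum in the corollary, in terms of words. -/
noncomputable def A (n m : ℕ) : ℝ≥0∞ :=
  ∑ j ∈ Finset.range m, Z (true :: (Y (m - 1 - j) ++ (X n ++ Y (j + 1))))

lemma cyc (n m : ℕ) (hn : 1 ≤ n) (hm : 1 ≤ m) (hfin : tr (X n ++ Y m) ≠ ⊤) :
    ∑ j ∈ Finset.range n, Z (X (n - j) ++ (Y m ++ (X j ++ [false]))) = A n m := by
  have h1 := phase1 m n 0 hm
  have h2 := phase2 n m 0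
  obtain ⟨n, rfl⟩ : ∃ k, n = k + 1 := ⟨n - 1, by omega⟩
  obtain ⟨m, rfl⟩ : ∃ k, m = k + 1 := ⟨m - 1, by omega⟩
  have hX0 : X 0 = [] := rfl
  have hY0 : Y 0 = [] := rfl
  simp only [zero_add, hX0, hY0, List.append_nil] at h1 h2
  rw [h2, add_assoc] at h1
  have h3 := (ENNReal.add_right_inj hfin).1 h1
  rw [h3]
  rw [Finset.sum_range_succ', Finset.sum_range_succ' _ n]
  have z1 : ∀ j, Z (X (n + 1 - (j + 1) + 1) ++ (Y (m + 1) ++ X (j + 1))) = 0 := by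
    intro j
    rw [X_succ' j, ← List.append_assoc, ← List.append_assoc]
    exact Z_snoc_x _
  have z2 : Z (true :: (Y (m + 1 - 0) ++ (X (n + 1) ++ Y 0))) = 0 := by
    rw [hY0, List.append_nil, X_succ' n, ← List.append_assoc, ← List.cons_append]
    exact Z_snoc_x _
  simp only [z1, z2, Finset.sum_const_zero, zero_add, add_zero, hX0, List.append_nil]
  unfold A
  rw [Finset.sum_range_succ]
  congr 1
  · apply Finset.sum_congr rfl
    intro j _
    congr 4
    omega
  · simp [hY0, X_succ]

lemma dual_sum (n m : ℕ) :
    ∑ j ∈ Finset.range n, Z (X (n - j) ++ (Y m ++ (X j ++ [false]))) = A m n := by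
  unfold A
  rw [← Finset.sum_range_reflect]
  apply Finset.sum_congr rfl
  intro j hj
  have hj := Finset.mem_range.1 hj
  obtain ⟨k, rfl⟩ : ∃ k, n = j + k + 1 := ⟨n - j - 1, by omega⟩
  rw [show j + k + 1 - 1 - j = k by omega, show j + k + 1 - k = j + 1 by omega]
  rw [X_succ, List.cons_append]
  have := duality (X j ++ (Y m ++ X k))
  simp only [List.append_assoc, dual_append, dual_X, dual_Y, ← Y_succ'] at this
  exact this

/-! ### Finiteness -/

/-- Harmonic numbers. -/
noncomputable def H (p : ℕ) : ℝ≥0∞ := ∑ r ∈ Finset.range (p + 1), iv r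

lemma H_mono {r p : ℕ} (h : r ≤ p) : H r ≤ H p := by
  unfold H
  exact Finset.sum_le_sum_of_subset (Finset.range_subset_range.2 (by omega))

lemma iv_le_H (p : ℕ) : iv p ≤ H p :=
  Finset.single_le_sum (f := iv) (fun _ _ => zero_le) (Finset.self_mem_range_succ p)

lemma M_bound (w : List Bool) (a : Bool) (p c : ℕ) :
    M (a :: w) p c ≤ iv p * H p ^ w.length := by
  induction w generalizing a p with
  | nil =>
    simp only [List.length_nil, pow_zero]
    cases a
    · simp only [M]
      gcongr
      rw [tsum_eq_single c (by intro b hb; simp [hb])]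
      simp only [lt]
      split_ifs <;> simp
    · simp only [M]
      gcongr
      split_ifs <;> simp
  | cons b w ih =>
    cases a
    · simp only [M]
      gcongr
      rw [sum_lt]
      calc ∑ r ∈ Finset.range p, M (b :: w) r c
          ≤ ∑ r ∈ Finset.range p, iv r * H p ^ w.length := by
            apply Finset.sum_le_sum
            intro r hr
            have := Finset.mem_range.1 hr
            refine (ih b r).trans ?_
            gcongr
            exact H_mono this.le
        _ = (∑ r ∈ Finset.range p, iv r) * H p ^ w.length := by rw [Finset.sum_mul]
        _ ≤ H p * H p ^ w.length := by
            gcongr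
            exact Finset.sum_le_sum_of_subset (Finset.range_subset_range.2 (by omega))
        _ = _ := by rw [List.length_cons, pow_succ']
    · rw [show M (true :: b :: w) p c = iv p * M (b :: w) p c from rfl]
      gcongr
      refine (ih b p).trans ?_
      rw [List.length_cons, pow_succ']
      gcongr
      exact iv_le_H p

lemma H_ofReal (p : ℕ) : H p = ENNReal.ofReal (harmonic p : ℝ) := by
  unfold H harmonic
  rw [Finset.sum_range_succ', iv_zero, add_zero]
  push_cast
  rw [ENNReal.ofReal_sum_of_nonneg (by intro i _; positivity)]
  apply Finset.sum_congr rfl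
  intro i _
  rw [iv_ofReal]
  push_cast
  rfl

lemma fin_sum (k : ℕ) : ∑' p, iv p * (iv p * H p ^ k) ≠ ⊤ := by
  have e : ∀ p, iv p * (iv p * H p ^ k) =
      ENNReal.ofReal ((p : ℝ)⁻¹ * ((p : ℝ)⁻¹ * (harmonic p : ℝ) ^ k)) := by
    intro p
    have : (0 : ℝ) ≤ (harmonic p : ℝ) := by
      unfold harmonic; push_cast; positivity
    rw [ENNReal.ofReal_mul (by positivity), ENNReal.ofReal_mul (by positivity),
      ENNReal.ofReal_pow this, iv_ofReal, H_ofReal]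
  simp only [e]
  apply Summable.tsum_ofReal_ne_top
  set ε : ℝ := 1 / (2 * (k + 1)) with hε
  have hε0 : 0 < ε := by positivity
  have hs : Summable (fun p : ℕ => (1 + 1 / ε) ^ k * (p : ℝ) ^ (-(3 / 2) : ℝ)) :=
    (Real.summable_nat_rpow.2 (by norm_num)).mul_left _
  refine Summable.of_nonneg_of_le (fun p => ?_) (fun p => ?_) hs
  · have : (0 : ℝ) ≤ (harmonic p : ℝ) := by
      unfold harmonic; push_cast; positivity
    positivity
  · have h0 : (0 : ℝ) ≤ (harmonic p : ℝ) := by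
      unfold harmonic; push_cast; positivity
    rcases Nat.eq_zero_or_pos p with rfl | hp
    · simp
    have hp1 : (1 : ℝ) ≤ p := by exact_mod_cast hp
    have hp0 : (0 : ℝ) < p := by linarith
    have h1 : (harmonic p : ℝ) ≤ (1 + 1 / ε) * (p : ℝ) ^ ε := by
      have a1 := harmonic_le_one_add_log p
      have a2 := Real.log_le_rpow_div hp0.le hε0
      have a3 := Real.one_le_rpow hp1 hε0.le
      calc (harmonic p : ℝ) ≤ 1 + Real.log p := a1
        _ ≤ (p : ℝ) ^ ε + (p : ℝ) ^ ε / ε := add_le_add a3 a2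
        _ = _ := by ring
    have h2 : (harmonic p : ℝ) ^ k ≤ (1 + 1 / ε) ^ k * (p : ℝ) ^ (1 / 2 : ℝ) := by
      calc (harmonic p : ℝ) ^ k ≤ ((1 + 1 / ε) * (p : ℝ) ^ ε) ^ k := by gcongr
        _ = (1 + 1 / ε) ^ k * (p : ℝ) ^ (ε * k) := by
          rw [mul_pow, Real.rpow_mul hp0.le, Real.rpow_natCast]
        _ ≤ _ := by
          gcongr
          rw [hε, div_mul_eq_mul_div, div_le_div_iff₀ (by positivity) (by positivity)]
          linarith
    calc (p : ℝ)⁻¹ * ((p : ℝ)⁻¹ * (harmonic p : ℝ) ^ k)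
        ≤ (p : ℝ)⁻¹ * ((p : ℝ)⁻¹ * ((1 + 1 / ε) ^ k * (p : ℝ) ^ (1 / 2 : ℝ))) := by gcongr
      _ = (1 + 1 / ε) ^ k * (((p : ℝ) ^ (-1 : ℝ)) * ((p : ℝ) ^ (-1 : ℝ) * (p : ℝ) ^ (1 / 2 : ℝ))) := by
        rw [Real.rpow_neg_one]; ring
      _ = _ := by
        rw [← Real.rpow_add hp0, ← Real.rpow_add hp0]
        norm_num

lemma Z_fin (b : Bool) (w : List Bool) : Z (true :: b :: w) ≠ ⊤ := by
  refine ne_top_of_le_ne_top (fin_sum w.length) ?_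
  unfold Z
  refine ENNReal.tsum_le_tsum fun p => ?_
  rw [show M (true :: b :: w) p 0 = iv p * M (b :: w) p 0 from rfl]
  gcongr
  exact M_bound w b p 0

lemma sum_iv (p : ℕ) : ∑' c, iv (p - c) = H p := by
  rw [tsum_eq_sum (s := Finset.range (p + 1))]
  · unfold H
    rw [← Finset.sum_range_reflect]
    apply Finset.sum_congr rfl
    intro j hj
    have := Finset.mem_range.1 hj
    congr 1
    omega
  · intro c hc
    simp only [Finset.mem_range] at hc
    rw [show p - c = 0 by omega, iv_zero]

lemma tr_fin (b : Bool) (w : List Bool) : tr (true :: b :: w) ≠ ⊤ := by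
  refine ne_top_of_le_ne_top (fin_sum (w.length + 1)) ?_
  unfold tr
  refine ENNReal.tsum_le_tsum fun p => ?_
  calc ∑' c, M (true :: b :: w) p c * iv (p - c)
      ≤ ∑' c, (iv p * (iv p * H p ^ w.length)) * iv (p - c) := by
        refine ENNReal.tsum_le_tsum fun c => ?_
        rw [show M (true :: b :: w) p c = iv p * M (b :: w) p c from rfl]
        gcongr
        exact M_bound w b p c
    _ = (iv p * (iv p * H p ^ w.length)) * H p := by rw [ENNReal.tsum_mul_left, sum_iv]
    _ = _ := by ring

lemma A_symm (n m : ℕ) (hn : 1 ≤ n) (hm : 1 ≤ m) : A n m = A m n := by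
  rw [← dual_sum n m]
  refine (cyc n m hn hm ?_).symm
  obtain ⟨n, rfl⟩ : ∃ k, n = k + 1 := ⟨n - 1, by omega⟩
  obtain ⟨m, rfl⟩ : ∃ k, m = k + 1 := ⟨m - 1, by omega⟩
  cases n with
  | zero => exact tr_fin _ _
  | succ n => exact tr_fin _ _

/-! ### Multiple zeta values -/

/-- Word of an index. -/
def word (k : List ℕ) : List Bool := k.flatMap (fun a => X (a - 1) ++ [false])

open Classical in
/-- Multiple zeta value with a restriction on the summation range. -/
noncomputable def E (k : List ℕ) (Q : ℕ → Prop) : ℝ≥0∞ :=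
  ∑' n : Fin k.length → ℕ,
    if (∀ i j : Fin k.length, i < j → n j < n i) ∧ (∀ i, 1 ≤ n i) ∧ (∀ i, Q (n i)) then
      ∏ i : Fin k.length, ((n i : ℝ≥0∞) ^ k.get i)⁻¹
    else 0

open Classical in
lemma E_cons (a : ℕ) (k : List ℕ) (Q : ℕ → Prop) (hQ : ∀ r p, r < p → Q p → Q r) :
    E (a :: k) Q = ∑' p : ℕ, if 1 ≤ p ∧ Q p then ((p : ℝ≥0∞) ^ a)⁻¹ * E k (· < p) else 0 := by
  have h := (Fin.consEquiv (fun _ : Fin (k.length + 1) => ℕ)).tsum_eq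
    (fun n : Fin (k.length + 1) → ℕ =>
      if (∀ i j : Fin (k.length + 1), i < j → n j < n i) ∧ (∀ i, 1 ≤ n i) ∧ (∀ i, Q (n i)) then
        ∏ i : Fin (k.length + 1), ((n i : ℝ≥0∞) ^ (a :: k).get i)⁻¹
      else 0)
  have h' : E (a :: k) Q = _ := h.symm
  rw [h', ENNReal.tsum_prod']
  refine tsum_congr fun p => ?_
  by_cases hp : 1 ≤ p ∧ Q p
  · rw [if_pos hp, E, ← ENNReal.tsum_mul_left]
    refine tsum_congr fun n => ?_
    have hiff : ((∀ i j : Fin (k.length + 1), i < j →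
        (Fin.cons p n : Fin (k.length + 1) → ℕ) j < (Fin.cons p n : Fin (k.length + 1) → ℕ) i) ∧
        (∀ i, 1 ≤ (Fin.cons p n : Fin (k.length + 1) → ℕ) i) ∧
        (∀ i, Q ((Fin.cons p n : Fin (k.length + 1) → ℕ) i))) ↔
        ((∀ i j : Fin k.length, i < j → n j < n i) ∧ (∀ i, 1 ≤ n i) ∧ (∀ i, n i < p)) := by
      simp only [Fin.forall_fin_succ, Fin.cons_zero, Fin.cons_succ, Fin.succ_lt_succ_iff,
        Fin.succ_pos, Fin.not_lt_zero, false_imp_iff, true_imp_iff, true_and]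
      constructor
      · rintro ⟨⟨h1, h2⟩, ⟨-, h3⟩, -, h4⟩
        exact ⟨h2, h3, h1⟩
      · rintro ⟨h1, h2, h3⟩
        exact ⟨⟨h3, h1⟩, ⟨hp.1, h2⟩, hp.2, fun i => hQ _ _ (h3 i) hp.2⟩
    simp only [Fin.consEquiv_apply]
    by_cases hc : (∀ i j : Fin k.length, i < j → n j < n i) ∧ (∀ i, 1 ≤ n i) ∧ (∀ i, n i < p)
    · rw [if_pos hc, if_pos (hiff.2 hc), Fin.prod_univ_succ]
      simp
    · rw [if_neg hc, if_neg (fun h => hc (hiff.1 h)), mul_zero]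
  · rw [if_neg hp, ENNReal.tsum_eq_zero]
    intro n
    rw [if_neg]
    rintro ⟨-, h1, h2⟩
    exact hp ⟨h1 0, h2 0⟩

lemma M_X (n : ℕ) (w : List Bool) (p c : ℕ) : M (X n ++ w) p c = iv p ^ n * M w p c := by
  induction n with
  | zero => simp [X]
  | succ n ih => simp only [X_succ, List.cons_append, M, ih, pow_succ']; ring

lemma word_cons (a : ℕ) (k : List ℕ) : word (a :: k) = X (a - 1) ++ false :: word k := by
  simp [word]

lemma M_word (a : ℕ) (ha : 1 ≤ a) (k : List ℕ) (p : ℕ) :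
    M (word (a :: k)) p 0 = iv p ^ a * ∑' r, lt r p * M (word k) r 0 := by
  obtain ⟨a, rfl⟩ : ∃ b, a = b + 1 := ⟨a - 1, by omega⟩
  rw [word_cons, M_X]
  simp only [M, Nat.add_sub_cancel, pow_succ]
  ring

lemma iv_pow (p a : ℕ) (hp : 1 ≤ p) : iv p ^ a = ((p : ℝ≥0∞) ^ a)⁻¹ := by
  rw [iv, if_neg (by omega), ENNReal.inv_pow]

lemma E_lt (k : List ℕ) (hk : ∀ a ∈ k, 1 ≤ a) (N : ℕ) (hN : 1 ≤ N) :
    E k (· < N) = ∑' r, lt r N * M (word k) r 0 := by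
  induction k generalizing N with
  | nil =>
    rw [tsum_eq_single 0 (by intro b hb; simp [word, M, hb])]
    simp [E, word, M, lt, show 0 < N by omega]
  | cons a k ih =>
    have ha : 1 ≤ a := hk a (by simp)
    rw [E_cons _ _ _ (fun r p h1 h2 => h1.trans h2)]
    refine tsum_congr fun p => ?_
    rw [M_word a ha]
    by_cases hp : 1 ≤ p
    · rw [ih (fun b hb => hk b (by simp [hb])) p hp, iv_pow p a hp]
      by_cases hpN : p < N <;> simp [hp, hpN, lt]
    · have : p = 0 := by omega
      subst this
      simp [iv_zero, show a ≠ 0 by omega]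

lemma E_true (a : ℕ) (k : List ℕ) (hk : ∀ b ∈ a :: k, 1 ≤ b) :
    E (a :: k) (fun _ => True) = Z (word (a :: k)) := by
  have ha : 1 ≤ a := hk a (by simp)
  rw [E_cons _ _ _ (fun r p h1 h2 => trivial), Z]
  refine tsum_congr fun p => ?_
  rw [M_word a ha]
  by_cases hp : 1 ≤ p
  · rw [E_lt k (fun b hb => hk b (by simp [hb])) p hp, iv_pow p a hp]
    simp [hp]
  · have : p = 0 := by omega
    subst this
    simp [iv_zero, show a ≠ 0 by omega]

lemma mzv_eq (a : ℕ) (k : List ℕ) (hk : ∀ b ∈ a :: k, 1 ≤ b) :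
    mzv (a :: k) = (Z (word (a :: k))).toReal := by
  rw [← E_true a k hk, E, ENNReal.tsum_toReal_eq]
  · unfold mzv
    refine tsum_congr fun n => ?_
    by_cases hc : (∀ i j : Fin (a :: k).length, i < j → n j < n i) ∧ (∀ i, 1 ≤ n i)
    · rw [if_pos hc, if_pos ⟨hc.1, hc.2, fun _ => trivial⟩, ENNReal.toReal_prod]
      simp
    · rw [if_neg hc, if_neg (fun h => hc ⟨h.1, h.2.1⟩), ENNReal.toReal_zero]
  · intro n
    split_ifs with hc
    · apply ENNReal.prod_ne_top
      intro i _
      have := hc.2.1 i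
      apply ENNReal.inv_ne_top.2
      apply pow_ne_zero
      exact_mod_cast (by omega : n i ≠ 0)
    · simp

lemma word_rep (c : ℕ) : word (List.replicate c 1) = Y c := by
  induction c with
  | zero => rfl
  | succ c ih => rw [List.replicate_succ, word_cons, ih]; rfl

lemma word_append (k l : List ℕ) : word (k ++ l) = word k ++ word l := by
  simp [word]

lemma main (n m : ℕ) (hm : 1 ≤ m) :
    mzv ((n + 2) :: List.replicate (m - 1) 1) +
        ∑ i ∈ Finset.Icc 1 (m - 1),
          mzv (2 :: (List.replicate (m - 1 - i) 1 ++ (n + 1) :: List.replicate (i - 1) 1)) =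
      (A n m).toReal := by
  obtain ⟨m, rfl⟩ : ∃ k, m = k + 1 := ⟨m - 1, by omega⟩
  have hfin : ∀ j ∈ Finset.range (m + 1),
      Z (true :: (Y (m + 1 - 1 - j) ++ (X n ++ Y (j + 1)))) ≠ ⊤ := by
    intro j _
    cases h : (Y (m + 1 - 1 - j) ++ (X n ++ Y (j + 1))) with
    | nil => simp [Y_succ] at h
    | cons b w => exact Z_fin b w
  rw [A, ENNReal.toReal_sum hfin, Finset.sum_range_succ, add_comm]
  simp only [Nat.add_sub_cancel]
  congr 1
  · have hs := Finset.sum_image (s := Finset.range m) (g := fun j => j + 1) (f := fun i =>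
      (Z (true :: (Y (m - (i - 1)) ++ (X n ++ Y i)))).toReal) (by intro a _ b _ h; simpa using h)
    simp only [Nat.add_sub_cancel] at hs
    have : Finset.image (fun j => j + 1) (Finset.range m) = Finset.Icc 1 m := by
      ext i
      simp only [Finset.mem_image, Finset.mem_range, Finset.mem_Icc]
      constructor
      · rintro ⟨j, hj, rfl⟩; omega
      · intro h; exact ⟨i - 1, by omega, by omega⟩
    rw [← hs, this]
    apply Finset.sum_congr rfl
    intro i hi
    have hi := Finset.mem_Icc.1 hi
    obtain ⟨j, rfl⟩ : ∃ j, i = j + 1 := ⟨i - 1, by omega⟩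
    obtain ⟨l, rfl⟩ : ∃ l, m = l + j + 1 := ⟨m - j - 1, by omega⟩
    rw [mzv_eq]
    · congr 2
      rw [word_cons, word_append, word_rep, word_cons, word_rep]
      simp only [Nat.add_sub_cancel]
      rw [show l + j + 1 - (j + 1) = l by omega, show l + j + 1 - j = l + 1 by omega,
        Y_succ, Y_succ]
      rfl
    · intro b hb
      simp only [List.mem_cons, List.mem_append, List.mem_replicate] at hb
      omega
  · rw [mzv_eq]
    · congr 2
      rw [word_cons, word_rep, Nat.sub_self, show n + 2 - 1 = n + 1 by omega, X_succ, Y_succ]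
      rfl
    · intro b hb
      simp only [List.mem_cons, List.mem_replicate] at hb
      omega

end CycSum

/-- **Corollary 5.5 (explicit form).**  For all integers `n, m ≥ 1`,
`ζ(n+2,1^{m-1}) + ∑_{i=1}^{m-1} ζ(2,1^{m-1-i},n+1,1^{i-1})
  = ζ(m+2,1^{n-1}) + ∑_{i=1}^{n-1} ζ(2,1^{n-1-i},m+1,1^{i-1})`,
where `1^c` denotes `c` consecutive entries equal to 1. -/
theorem corollary_5_5 (n m : ℕ) (hn : 1 ≤ n) (hm : 1 ≤ m) :
    mzv ((n + 2) :: List.replicate (m - 1) 1) +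
        ∑ i ∈ Finset.Icc 1 (m - 1),
          mzv (2 :: (List.replicate (m - 1 - i) 1 ++ (n + 1) :: List.replicate (i - 1) 1)) =
      mzv ((m + 2) :: List.replicate (n - 1) 1) +
        ∑ i ∈ Finset.Icc 1 (n - 1),
          mzv (2 :: (List.replicate (n - 1 - i) 1 ++ (m + 1) :: List.replicate (i - 1) 1)) := by
  rw [CycSum.main n m hm, CycSum.main m n hn, CycSum.A_symm n m hn hm]
end

section
/- (Cyclic sum theorem applied to the periodic word z_n^l.) For all integers n ≥ 2 and l ≥ 1: ζ(n+1, n^{l−1}) = ∑_{i=0}^{n−2} ζ(n−i, n^{l−1}, i+1), where n^{l−1} denotes l−1 consecutive entries equal to n (so the left side is ζ(n+1, n, …, n) with l−1 copies of n, and each right-hand term is ζ(n−i, n, …, n, i+1) with l−1 copies of n in the middle). -/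
open scoped ENNReal

noncomputable def ezw (k x : ℕ) : ℝ≥0∞ := ENNReal.ofReal (((x : ℝ) ^ k)⁻¹)

noncomputable def Zrec : List ℕ → ℕ∞ → ℝ≥0∞
  | [], _ => 1
  | k :: ks, N => ∑' x : ℕ, if 1 ≤ x ∧ (x : ℕ∞) < N then ezw k x * Zrec ks x else 0

noncomputable def Wr (n : ℕ) : ℕ → ℕ → ℕ → ℝ≥0∞
  | 0, a, b => if b < a then 1 else 0
  | r + 1, a, b => ∑' x : ℕ, if x < a then ezw n x * Wr n r x b else 0

noncomputable def dw (a m : ℕ) : ℝ≥0∞ := ENNReal.ofReal (((a : ℝ) - m)⁻¹)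

lemma Zrec_eq (ks : List ℕ) : ∀ N : ℕ∞,
    (∑' n : Fin ks.length → ℕ,
      if (∀ i j : Fin ks.length, i < j → n j < n i) ∧ (∀ i, 1 ≤ n i) ∧ (∀ i, (n i : ℕ∞) < N) then
        ∏ i : Fin ks.length, ezw (ks.get i) (n i) else 0) = Zrec ks N := by
  induction ks with
  | nil => 
    intro N
    have : Unique (Fin ([] : List ℕ).length → ℕ) := inferInstanceAs (Unique (Fin 0 → ℕ))
    rw [tsum_eq_single default (fun b hb => absurd (Subsingleton.elim b default) hb)]
    simp [Zrec]
  | cons k ks ih =>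
    intro N
    rw [Zrec]
    refine ((Fin.consEquiv (fun _ : Fin (ks.length + 1) => ℕ)).tsum_eq _).symm.trans ?_
    refine (ENNReal.summable.tsum_prod' (fun _ => ENNReal.summable)).trans ?_
    refine tsum_congr fun x => ?_
    rw [← ih x]
    split_ifs with h
    · rw [← ENNReal.tsum_mul_left]
      refine tsum_congr fun y => ?_
      rw [mul_ite, mul_zero]
      have hiff : ((∀ i j : Fin (ks.length + 1), i < j →
            (Fin.cons x y : Fin (ks.length + 1) → ℕ) j < (Fin.cons x y : Fin (ks.length + 1) → ℕ) i) ∧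
          (∀ i, 1 ≤ (Fin.cons x y : Fin (ks.length + 1) → ℕ) i) ∧
          (∀ i, (((Fin.cons x y : Fin (ks.length + 1) → ℕ) i : ℕ) : ℕ∞) < N)) ↔
          ((∀ i j : Fin ks.length, i < j → y j < y i) ∧ (∀ i, 1 ≤ y i) ∧
            (∀ i, (y i : ℕ∞) < (x : ℕ∞))) := by
        simp only [Fin.forall_fin_succ, Fin.cons_zero, Fin.cons_succ, Fin.succ_lt_succ_iff,
          Fin.succ_pos, Nat.cast_lt, lt_self_iff_false, Fin.not_lt_zero, forall_true_left, false_imp_iff, true_and]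
        constructor
        · rintro ⟨⟨h1, h2⟩, h3, h4⟩
          exact ⟨h2, h3.2, h1⟩
        · rintro ⟨h1, h2, h3⟩
          exact ⟨⟨h3, h1⟩, ⟨h.1, h2⟩, h.2, fun i => lt_trans (by exact_mod_cast h3 i) h.2⟩
      refine (if_congr hiff ?_ rfl)
      exact (Fin.prod_univ_succ (n := ks.length) _)
    · refine ENNReal.tsum_eq_zero.2 fun y => if_neg ?_
      rintro ⟨-, h2, h3⟩
      exact h ⟨h2 (0 : Fin (ks.length + 1)), h3 (0 : Fin (ks.length + 1))⟩

lemma mzv_eq (ks : List ℕ) : mzv ks = (Zrec ks ⊤).toReal := by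
  rw [← Zrec_eq, ENNReal.tsum_toReal_eq]
  · refine tsum_congr fun n => ?_
    have : ∀ i, ((n i : ℕ) : ℕ∞) < ⊤ := fun i => ENat.natCast_lt_top _
    simp only [this, implies_true, and_true]
    split_ifs
    · rw [ENNReal.toReal_prod]
      refine Finset.prod_congr rfl fun i _ => ?_
      rw [ezw, ENNReal.toReal_ofReal (by positivity)]
    · simp
  · intro n
    split_ifs
    · exact ENNReal.prod_ne_top fun i _ => ENNReal.ofReal_ne_top
    · simp

lemma Wr_zero_of_le (n r a b : ℕ) (h : a ≤ b) : Wr n r a b = 0 := by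
  induction r generalizing a with
  | zero => simp [Wr, h]
  | succ r ih =>
    rw [Wr]
    refine ENNReal.tsum_eq_zero.2 fun x => ?_
    split_ifs with hx
    · rw [ih x (by omega), mul_zero]
    · rfl

lemma Wr_right (n r : ℕ) : ∀ a b, Wr n (r + 1) a b =
    ∑' x : ℕ, if b < x then Wr n r a x * ezw n x else 0 := by
  induction r with
  | zero =>
    intro a b
    simp only [Wr]
    refine tsum_congr fun x => ?_
    split_ifs <;> simp
  | succ r ih =>
    intro a b
    rw [Wr]
    have h1 : ∀ x, (if x < a then ezw n x * Wr n (r + 1) x b else 0) =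
        ∑' y, if x < a ∧ b < y then ezw n x * (Wr n r x y * ezw n y) else 0 := by
      intro x
      rw [ih]
      by_cases hx : x < a
      · simp only [hx, if_true, true_and]
        rw [← ENNReal.tsum_mul_left]
        refine tsum_congr fun y => ?_
        rw [mul_ite, mul_zero]
      · simp [hx]
    simp_rw [h1]
    rw [ENNReal.tsum_comm]
    refine tsum_congr fun y => ?_
    by_cases hy : b < y
    · simp only [hy, if_true, and_true]
      rw [Wr, ← ENNReal.tsum_mul_right]
      refine tsum_congr fun x => ?_
      rw [ite_mul, zero_mul, mul_assoc]
    · simp [hy]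

lemma Zrec_replicate (n r : ℕ) : ∀ a : ℕ, 1 ≤ a → Zrec (List.replicate r n) a = Wr n r a 0 := by
  induction r with
  | zero => intro a ha; simp [Zrec, Wr, Nat.pos_iff_ne_zero.1 ha]
  | succ r ih =>
    intro a ha
    rw [List.replicate_succ, Zrec, Wr]
    refine tsum_congr fun x => ?_
    simp only [Nat.cast_lt]
    by_cases hx : 1 ≤ x
    · simp [hx, ih x hx]
    · rw [Wr_zero_of_le n r x 0 (by omega)]; simp [hx]

lemma Zrec_replicate_append (n r j : ℕ) : ∀ a : ℕ,
    Zrec (List.replicate r n ++ [j]) a = ∑' b : ℕ, if 1 ≤ b then Wr n r a b * ezw j b else 0 := by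
  induction r with
  | zero =>
    intro a
    simp only [List.replicate_zero, List.nil_append, Zrec, Wr, Nat.cast_lt]
    refine tsum_congr fun x => ?_
    by_cases h : 1 ≤ x <;> by_cases h' : x < a <;> simp [h, h']
  | succ r ih =>
    intro a
    rw [List.replicate_succ, List.cons_append, Zrec]
    simp only [ih, Wr, Nat.cast_lt]
    have h1 : ∀ b, (if 1 ≤ b then (∑' x, if x < a then ezw n x * Wr n r x b else 0) * ezw j b else 0)
        = ∑' x, if x < a ∧ 1 ≤ b then ezw n x * Wr n r x b * ezw j b else 0 := by
      intro b
      by_cases hb : 1 ≤ b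
      · simp only [hb, if_true, and_true]
        rw [← ENNReal.tsum_mul_right]
        refine tsum_congr fun y => ?_
        rw [ite_mul, zero_mul]
      · simp [hb]
    simp_rw [h1]
    rw [ENNReal.tsum_comm]
    refine tsum_congr fun x => ?_
    by_cases hx : x < a
    · by_cases hx1 : 1 ≤ x
      · simp only [hx, hx1, if_true, true_and]
        rw [← ENNReal.tsum_mul_left]
        refine tsum_congr fun y => ?_
        rw [mul_ite, mul_zero, mul_assoc]
      · simp only [hx, hx1, if_false, false_and, true_and]
        symm
        refine ENNReal.tsum_eq_zero.2 fun y => ?_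
        rw [Wr_zero_of_le n r x y (by omega)]; simp
    · simp [hx]

noncomputable def Ztwo (n r k j : ℕ) : ℝ≥0∞ :=
  ∑' a : ℕ, ∑' m : ℕ, if 1 ≤ m then ezw k a * Wr n r a m * ezw j m else 0

noncomputable def Sr (n r k j : ℕ) : ℝ≥0∞ :=
  ∑' a : ℕ, ∑' m : ℕ, if 1 ≤ m then ezw k a * Wr n r a m * ezw j m * dw a m else 0

noncomputable def Tr (n r : ℕ) : ℝ≥0∞ :=
  ∑' a : ℕ, ∑' m : ℕ, ezw n a * Wr n r a m * dw a m

noncomputable def Zone (n r : ℕ) : ℝ≥0∞ := ∑' a : ℕ, ezw (n + 1) a * Wr n r a 0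

lemma Zrec_one (n r : ℕ) : Zrec ((n + 1) :: List.replicate r n) ⊤ = Zone n r := by
  rw [Zrec, Zone]
  refine tsum_congr fun a => ?_
  by_cases ha : 1 ≤ a
  · simp [ha, Zrec_replicate n r a ha]
  · rw [Wr_zero_of_le n r a 0 (by omega)]; simp [ha]

lemma Zrec_two (n r k j : ℕ) : Zrec (k :: (List.replicate r n ++ [j])) ⊤ = Ztwo n r k j := by
  rw [Zrec, Ztwo]
  refine tsum_congr fun a => ?_
  rw [Zrec_replicate_append]
  by_cases ha : 1 ≤ a
  · simp only [ha, ENat.natCast_lt_top, true_and, if_true]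
    rw [← ENNReal.tsum_mul_left]
    refine tsum_congr fun y => ?_
    rw [mul_ite, mul_zero, mul_assoc]
  · simp only [ha, false_and, if_false]
    symm
    refine ENNReal.tsum_eq_zero.2 fun y => ?_
    rw [Wr_zero_of_le n r a y (by omega)]; simp

lemma Sr_step (n r k j : ℕ) : Sr n r (k + 1) j + Ztwo n r (k + 1) (j + 1) = Sr n r k (j + 1) := by
  simp only [Sr, Ztwo]
  rw [← ENNReal.tsum_add]
  refine tsum_congr fun a => ?_
  rw [← ENNReal.tsum_add]
  refine tsum_congr fun m => ?_
  by_cases hm : 1 ≤ m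
  · simp only [hm, if_true]
    by_cases ha : a ≤ m
    · simp [Wr_zero_of_le n r a m ha]
    · push Not at ha
      have key : ezw (k + 1) a * ezw j m * dw a m + ezw (k + 1) a * ezw (j + 1) m =
          ezw k a * ezw (j + 1) m * dw a m := by
        have hm' : (0 : ℝ) < m := by exact_mod_cast hm
        have ha' : (m : ℝ) < a := by exact_mod_cast ha
        have hd : (0 : ℝ) < (a : ℝ) - m := by linarith
        have ha0 : (0 : ℝ) < a := by linarith
        simp only [ezw, dw]
        rw [← ENNReal.ofReal_mul (by positivity), ← ENNReal.ofReal_mul (by positivity),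
          ← ENNReal.ofReal_mul (by positivity), ← ENNReal.ofReal_mul (by positivity),
          ← ENNReal.ofReal_mul (by positivity), ← ENNReal.ofReal_add (by positivity) (by positivity)]
        congr 1
        rw [pow_succ, pow_succ]
        field_simp
        ring
      calc _ = Wr n r a m * (ezw (k + 1) a * ezw j m * dw a m + ezw (k + 1) a * ezw (j + 1) m) := by
            ring
        _ = _ := by rw [key]; ring
  · simp [hm]

lemma Sr_iter (n r p : ℕ) (hp : p ≤ n) :
    Sr n r n 0 + ∑ i ∈ Finset.range p, Ztwo n r (n - i) (i + 1) = Sr n r (n - p) p := by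
  induction p with
  | zero => simp
  | succ p ih =>
    rw [Finset.sum_range_succ, ← add_assoc, ih (by omega)]
    have : n - p = (n - (p + 1)) + 1 := by omega
    rw [this, Sr_step]

lemma Tr_eq (n r : ℕ) : Tr n r = Zone n r + Sr n r n 0 := by
  rw [Tr, Zone, Sr, ← ENNReal.tsum_add]
  refine tsum_congr fun a => ?_
  rw [tsum_eq_zero_add' (f := fun m => ezw n a * Wr n r a m * dw a m) ENNReal.summable,
    tsum_eq_zero_add' (f := fun m => if 1 ≤ m then ezw n a * Wr n r a m * ezw 0 m * dw a m else 0)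
      ENNReal.summable]
  simp only [Nat.le_add_left, if_true, ezw, pow_zero, inv_one, ENNReal.ofReal_one, mul_one]
  rw [if_neg (by norm_num : ¬ (1 : ℕ) ≤ 0), zero_add]
  congr 1
  simp only [dw, Nat.cast_zero, sub_zero, pow_succ, mul_inv]
  rw [ENNReal.ofReal_mul (by positivity)]
  ring

lemma tele1 (x m : ℕ) (h : m < x) :
    (∑' a : ℕ, if x < a then ENNReal.ofReal ((((a : ℝ) - m - 1) * ((a : ℝ) - m))⁻¹) else 0) =
      dw x m := by
  rw [← Summable.sum_add_tsum_nat_add' (k := x + 1) ENNReal.summable, Finset.sum_eq_zero, zero_add]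
  · have h1 : ∀ i : ℕ, x < i + (x + 1) := fun i => by omega
    simp only [h1, if_true, dw]
    have hx : (m : ℝ) + 1 ≤ x := by exact_mod_cast h
    set f : ℕ → ℝ := fun i => ((x : ℝ) - m + i)⁻¹ with hf
    have hs : HasSum (fun i => f i - f (i + 1)) ((x : ℝ) - m)⁻¹ := by
      rw [hasSum_iff_tendsto_nat_of_nonneg]
      · simp_rw [Finset.sum_range_sub']
        have : Filter.Tendsto f Filter.atTop (nhds 0) := 
          (Filter.tendsto_atTop_add_const_left _ _ tendsto_natCast_atTop_atTop).inv_tendsto_atTop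
        have h2 := (tendsto_const_nhds (x := f 0)).sub this
        simpa [hf] using h2
      · intro i
        rw [sub_nonneg]
        simp only [hf]
        apply inv_anti₀
        · have : (0 : ℝ) ≤ i := by positivity
          linarith
        · push_cast; linarith
    rw [← hs.tsum_eq, ENNReal.ofReal_tsum_of_nonneg _ hs.summable]
    · refine tsum_congr fun i => ?_
      congr 1
      simp only [hf]
      have : (0 : ℝ) ≤ i := by positivity
      have h3 : (0 : ℝ) < (x : ℝ) - m + i := by linarith
      have h4 : (0 : ℝ) < (x : ℝ) - m + (i + 1) := by linarith
      have e1 : ((i + (x + 1) : ℕ) : ℝ) - m - 1 = (x : ℝ) - m + i := by push_cast; ring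
      have e2 : ((i + (x + 1) : ℕ) : ℝ) - m = (x : ℝ) - m + (i + 1) := by push_cast; ring
      rw [e1, e2]
      push_cast
      field_simp
      ring
    · intro i
      rw [sub_nonneg]
      simp only [hf]
      apply inv_anti₀
      · have : (0 : ℝ) ≤ i := by positivity
        linarith
      · push_cast; linarith
  · intro a ha
    have := Finset.mem_range.1 ha
    exact if_neg (by omega)

lemma tele (x m : ℕ) (h : m ≤ x) :
    (∑' a : ℕ, if x < a then ENNReal.ofReal ((m : ℝ) * ((a : ℝ) * ((a : ℝ) - m))⁻¹) else 0) =
      ∑ j ∈ Finset.range m, dw x j := by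
  induction m with
  | zero => simp
  | succ m ih =>
    rw [Finset.sum_range_succ, ← ih (by omega), ← tele1 x m (by omega), ← ENNReal.tsum_add]
    refine tsum_congr fun a => ?_
    by_cases ha : x < a
    · simp only [ha, if_true]
      have h1 : (m : ℝ) + 1 < a := by exact_mod_cast (by omega : m + 1 < a)
      have h0 : (0 : ℝ) ≤ m := by positivity
      have h2 : (0 : ℝ) < (a : ℝ) - m := by linarith
      have h3 : (0 : ℝ) < (a : ℝ) - m - 1 := by linarith
      have h4 : (0 : ℝ) < (a : ℝ) := by linarith
      rw [← ENNReal.ofReal_add (by positivity) (by positivity)]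
      congr 1
      have h5 : (a : ℝ) - ((m + 1 : ℕ) : ℝ) = (a : ℝ) - m - 1 := by push_cast; ring
      rw [h5]
      push_cast
      field_simp
      ring
    · simp [ha]

/-- the basic weight identity used for the last step -/
lemma wt_id (n a m : ℕ) (hm : 1 ≤ m) (ha : m < a) (hn : 1 ≤ n) :
    ezw 1 a * ezw (n - 1) m * dw a m =
      ezw n m * ENNReal.ofReal ((m : ℝ) * ((a : ℝ) * ((a : ℝ) - m))⁻¹) := by
  have hm' : (0 : ℝ) < m := by exact_mod_cast hm
  have ha' : (m : ℝ) < a := by exact_mod_cast ha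
  have hd : (0 : ℝ) < (a : ℝ) - m := by linarith
  have ha0 : (0 : ℝ) < a := by linarith
  obtain ⟨k, rfl⟩ : ∃ k, n = k + 1 := ⟨n - 1, by omega⟩
  simp only [ezw, dw, Nat.add_sub_cancel]
  rw [← ENNReal.ofReal_mul (by positivity), ← ENNReal.ofReal_mul (by positivity),
    ← ENNReal.ofReal_mul (by positivity)]
  congr 1
  field_simp
  ring

lemma sum_dw (x m : ℕ) : ∑ j ∈ Finset.range m, dw x j = ∑' j, if j < m then dw x j else 0 := by
  rw [tsum_eq_sum (s := Finset.range m)]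
  · refine Finset.sum_congr rfl fun j hj => ?_
    rw [if_pos (Finset.mem_range.1 hj)]
  · intro j hj
    rw [if_neg (by simpa using hj)]

lemma Sr_last (n r : ℕ) (hn : 1 ≤ n) : Sr n r 1 (n - 1) = Tr n r := by
  cases r with
  | zero =>
    rw [Sr, Tr, ENNReal.tsum_comm]
    refine tsum_congr fun m => ?_
    have hR : (∑' j, ezw n m * Wr n 0 m j * dw m j) = ezw n m * ∑ j ∈ Finset.range m, dw m j := by
      rw [sum_dw, ← ENNReal.tsum_mul_left]
      refine tsum_congr fun j => ?_
      simp only [Wr]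
      split_ifs <;> simp
    rw [hR, ← tele m m le_rfl, ← ENNReal.tsum_mul_left]
    refine tsum_congr fun a => ?_
    by_cases hm : 1 ≤ m
    · by_cases ha : m < a
      · simp only [hm, ha, if_true, Wr, mul_one]
        exact wt_id n a m hm ha hn
      · simp [ha, Wr]
    · obtain rfl : m = 0 := by omega
      simp
  | succ s =>
    -- left side, as a sum over x, m, a
    have hL : Sr n (s + 1) 1 (n - 1) = ∑' x, ∑' m, ezw n x * Wr n s x m * ezw n m *
        ∑ j ∈ Finset.range m, dw x j := by
      rw [Sr]
      have h1 : ∀ a m, (if 1 ≤ m then ezw 1 a * Wr n (s + 1) a m * ezw (n - 1) m * dw a m else 0) =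
          ∑' x, ezw n x * Wr n s x m * ezw n m *
            (if x < a then ENNReal.ofReal ((m : ℝ) * ((a : ℝ) * ((a : ℝ) - m))⁻¹) else 0) := by
        intro a m
        by_cases hm : 1 ≤ m
        · simp only [hm, if_true]
          rw [Wr]
          calc _ = (∑' x, if x < a then ezw n x * Wr n s x m else 0) *
                  (ezw 1 a * ezw (n - 1) m * dw a m) := by ring
            _ = _ := by
              rw [← ENNReal.tsum_mul_right]
              refine tsum_congr fun x => ?_
              by_cases hx : x < a
              · simp only [hx, if_true]
                by_cases hmx : x ≤ m
                · simp [Wr_zero_of_le n s x m hmx]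
                · rw [wt_id n a m hm (by omega) hn]; ring
              · simp [hx]
        · obtain rfl : m = 0 := by omega
          simp
      simp_rw [h1]
      have h2 : ∀ a, (∑' m, ∑' x, ezw n x * Wr n s x m * ezw n m *
            (if x < a then ENNReal.ofReal ((m : ℝ) * ((a : ℝ) * ((a : ℝ) - m))⁻¹) else 0)) =
          ∑' x, ∑' m, ezw n x * Wr n s x m * ezw n m *
            (if x < a then ENNReal.ofReal ((m : ℝ) * ((a : ℝ) * ((a : ℝ) - m))⁻¹) else 0) :=
        fun a => ENNReal.tsum_comm
      simp_rw [h2]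
      rw [ENNReal.tsum_comm]
      refine tsum_congr fun x => ?_
      rw [ENNReal.tsum_comm]
      refine tsum_congr fun m => ?_
      rw [ENNReal.tsum_mul_left]
      by_cases hmx : x ≤ m
      · simp [Wr_zero_of_le n s x m hmx]
      · rw [tele x m (by omega)]
    rw [hL, Tr]
    refine tsum_congr fun x => ?_
    have h3 : ∀ m, ezw n x * Wr n s x m * ezw n m * ∑ j ∈ Finset.range m, dw x j =
        ∑' j, ezw n x * (if j < m then Wr n s x m * ezw n m else 0) * dw x j := by
      intro m
      rw [sum_dw, ← ENNReal.tsum_mul_left]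
      refine tsum_congr fun j => ?_
      split_ifs
      · ring
      · simp
    simp_rw [h3]
    rw [ENNReal.tsum_comm]
    refine tsum_congr fun j => ?_
    rw [ENNReal.tsum_mul_right, ENNReal.tsum_mul_left, ← Wr_right]

lemma ezw_sum_ne_top (n : ℕ) (hn : 2 ≤ n) : (∑' x, ezw n x) ≠ ⊤ := by
  have : Summable (fun x : ℕ => ((x : ℝ) ^ n)⁻¹) := Real.summable_nat_pow_inv.2 (by omega)
  exact this.tsum_ofReal_ne_top

lemma Wr_le (n r : ℕ) : ∀ a m, Wr n r a m ≤ (∑' x, ezw n x) ^ r := by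
  induction r with
  | zero => intro a m; simp only [Wr, pow_zero]; split_ifs <;> simp
  | succ r ih =>
    intro a m
    rw [Wr, pow_succ', ← ENNReal.tsum_mul_right]
    refine ENNReal.tsum_le_tsum fun x => ?_
    split_ifs
    · exact mul_le_mul_right (ih x m) _
    · simp

noncomputable def gw (x : ℕ) : ℝ≥0∞ := ENNReal.ofReal (((x : ℝ) ^ (3 / 2 : ℝ))⁻¹)

lemma gw_sum_ne_top : (∑' x, gw x) ≠ ⊤ := by
  have : Summable (fun x : ℕ => ((x : ℝ) ^ (3 / 2 : ℝ))⁻¹) :=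
    Real.summable_nat_rpow_inv.2 (by norm_num)
  exact this.tsum_ofReal_ne_top

lemma gw_bound (n a m : ℕ) (hn : 2 ≤ n) (h : m < a) : ezw n a * dw a m ≤ gw a * gw (a - m) := by
  obtain ⟨d, rfl⟩ : ∃ d, a = m + d := ⟨a - m, by omega⟩
  have hd : 1 ≤ d := by omega
  have hd' : (1 : ℝ) ≤ d := by exact_mod_cast hd
  simp only [ezw, dw, gw, Nat.add_sub_cancel_left]
  rw [← ENNReal.ofReal_mul (by positivity), ← ENNReal.ofReal_mul (by positivity)]
  apply ENNReal.ofReal_le_ofReal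
  have e : ((m + d : ℕ) : ℝ) - m = d := by push_cast; ring
  rw [e, ← mul_inv, ← mul_inv]
  set A : ℝ := ((m + d : ℕ) : ℝ) with hA
  have hAd : (d : ℝ) ≤ A := by rw [hA]; push_cast; linarith [(Nat.cast_nonneg m : (0 : ℝ) ≤ m)]
  have hA1 : 1 ≤ A := hd'.trans hAd
  apply inv_anti₀ (by positivity)
  have r1 : ∀ y : ℝ, 1 ≤ y → y ^ (3 / 2 : ℝ) = y * y ^ (1 / 2 : ℝ) := by
    intro y hy
    rw [show (3 / 2 : ℝ) = 1 + 1 / 2 by norm_num, Real.rpow_add (by linarith), Real.rpow_one]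
  have r2 : A ^ (1 / 2 : ℝ) * A ^ (1 / 2 : ℝ) = A := by
    rw [← Real.rpow_add (by linarith)]; norm_num
  calc A ^ (3 / 2 : ℝ) * (d : ℝ) ^ (3 / 2 : ℝ)
      = (A * d) * (A ^ (1 / 2 : ℝ) * (d : ℝ) ^ (1 / 2 : ℝ)) := by
        rw [r1 A hA1, r1 d hd']; ring
    _ ≤ (A * d) * (A ^ (1 / 2 : ℝ) * A ^ (1 / 2 : ℝ)) := by gcongr
    _ = A ^ 2 * d := by rw [r2]; ring
    _ ≤ A ^ n * d := by gcongr

lemma Tr_ne_top (n r : ℕ) (hn : 2 ≤ n) : Tr n r ≠ ⊤ := by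
  set C := (∑' x, ezw n x) ^ r with hC
  set G := ∑' x, gw x with hG
  have hle : Tr n r ≤ C * (G * G) := by
    rw [Tr]
    have h1 : ∀ a, (∑' m, ezw n a * Wr n r a m * dw a m) ≤ C * (gw a * G) := by
      intro a
      calc _ ≤ ∑' m, C * (gw a * (if m < a then gw (a - m) else 0)) := by
            refine ENNReal.tsum_le_tsum fun m => ?_
            by_cases h : m < a
            · simp only [h, if_true]
              calc _ = Wr n r a m * (ezw n a * dw a m) := by ring
                _ ≤ _ := mul_le_mul' (Wr_le n r a m) (gw_bound n a m hn h)
            · simp [Wr_zero_of_le n r a m (by omega)]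
        _ = C * (gw a * ∑' m, (if m < a then gw (a - m) else 0)) := by
            rw [ENNReal.tsum_mul_left, ENNReal.tsum_mul_left]
        _ ≤ _ := by
            gcongr
            rw [tsum_eq_sum (s := Finset.range a) (by
              intro j hj; rw [if_neg (by simpa using hj)])]
            calc _ = ∑ j ∈ Finset.range a, (fun i => gw (i + 1)) (a - 1 - j) := by
                  refine Finset.sum_congr rfl fun j hj => ?_
                  have := Finset.mem_range.1 hj
                  rw [if_pos this]
                  simp only
                  congr 1
                  omega
              _ = ∑ j ∈ Finset.range a, gw (j + 1) := Finset.sum_range_reflect (fun i => gw (i + 1)) a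
              _ ≤ ∑' j, gw (j + 1) := ENNReal.sum_le_tsum _
              _ ≤ G := ENNReal.tsum_comp_le_tsum_of_injective (add_left_injective 1) _
    calc _ ≤ ∑' a, C * (gw a * G) := ENNReal.tsum_le_tsum h1
      _ = _ := by rw [ENNReal.tsum_mul_left, ENNReal.tsum_mul_right]
  refine ne_top_of_le_ne_top ?_ hle
  exact ENNReal.mul_ne_top (ENNReal.pow_ne_top (ezw_sum_ne_top n hn))
    (ENNReal.mul_ne_top gw_sum_ne_top gw_sum_ne_top)

/-- **Cyclic sum theorem for the periodic word `z_n^l`.**  For `n ≥ 2` and `l ≥ 1`,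
`ζ(n+1, n^{l-1}) = ∑_{i=0}^{n-2} ζ(n-i, n^{l-1}, i+1)`,
where `n^{l-1}` denotes `l-1` consecutive entries equal to `n`. -/
theorem cyclic_sum_periodic (n l : ℕ) (hn : 2 ≤ n) (hl : 1 ≤ l) :
    mzv ((n + 1) :: List.replicate (l - 1) n) =
      ∑ i ∈ Finset.range (n - 1),
        mzv ((n - i) :: (List.replicate (l - 1) n ++ [i + 1])) := by
  simp_rw [mzv_eq, Zrec_one, Zrec_two]
  have hT := Tr_ne_top n (l - 1) hn
  have h1 := Tr_eq n (l - 1)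
  have h2 := Sr_iter n (l - 1) (n - 1) (by omega)
  rw [show n - (n - 1) = 1 by omega, Sr_last n (l - 1) (by omega)] at h2
  have hsum : ∑ i ∈ Finset.range (n - 1), Ztwo n (l - 1) (n - i) (i + 1) ≠ ⊤ :=
    ne_top_of_le_ne_top hT (h2 ▸ le_add_self)
  have hS : Sr n (l - 1) n 0 ≠ ⊤ := ne_top_of_le_ne_top hT (h2 ▸ le_self_add)
  rw [← ENNReal.toReal_sum (fun i hi => ENNReal.sum_ne_top.1 hsum i hi)]
  congr 1
  rw [h1, add_comm] at h2
  exact ((ENNReal.add_left_inj hS).1 h2).symm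
end
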